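/- arXiv:0710.4991 — 6 statements merged into one kernel-verified Lean document; each statement's English description precedes it below -/
import Mathlib

section
/- The quadratic form x² + y² + z² over ℤ represents every positive integer except those of the form 4^a(8b+7); equivalently, a positive integer n is not a sum of three integer squares if and only if n = 2^e·u where e is even and u ≡ 7 (mod 8). -/
open scoped NumberTheorySymbols

/-- Every integer can be translated by a multiple of `a > 0` into `[-a / 2, a / 2]`. -/
theorem Int.exists_abs_two_mul_add_mul_le {a : ℤ} (ha : 0 < a) (f : ℤ) :
    ∃ t : ℤ, |2 * (f + a * t)| ≤ a := by
  refine ⟨-((2 * f + a) / (2 * a)), ?_⟩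
  have h₁ := Int.emod_nonneg (2 * f + a) (by lia : 2 * a ≠ 0)
  have h₂ := Int.emod_lt_of_pos (2 * f + a) (by lia : 0 < 2 * a)
  have h₃ := Int.emod_add_mul_ediv (2 * f + a) (2 * a)
  rw [abs_le]
  constructor <;> linarith

/-- Lagrange reduction: a positive definite binary form `a x² + 2 b x y + c y²` of determinant `D`
takes a positive value `m` with `3 m² ≤ 4 D` at a vector which is part of a basis of `ℤ²`. -/
theorem exists_binary_value_sq_le (a b c : ℤ) (ha : 0 < a) (hD : 0 < a * c - b ^ 2) :
    ∃ p q r s : ℤ, p * s - q * r = 1 ∧ 0 < a * p ^ 2 + 2 * b * p * r + c * r ^ 2 ∧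
      3 * (a * p ^ 2 + 2 * b * p * r + c * r ^ 2) ^ 2 ≤ 4 * (a * c - b ^ 2) := by
  induction hk : a.toNat using Nat.strong_induction_on generalizing a b c with
  | _ k ih =>
    obtain ⟨t, ht⟩ := Int.exists_abs_two_mul_add_mul_le ha b
    set b' := b + a * t with hb'
    set c' := c + 2 * b * t + a * t ^ 2 with hc'
    have hdet : a * c' - b' ^ 2 = a * c - b ^ 2 := by rw [hb', hc']; ring
    have hsq : 4 * b' ^ 2 ≤ a ^ 2 := by
      have := sq_le_sq' (abs_le.mp ht).1 (abs_le.mp ht).2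
      linarith
    rcases le_or_gt a c' with hac | hac
    · refine ⟨1, 0, 0, 1, by ring, by simpa using ha, ?_⟩
      nlinarith
    · have hc : 0 < c' := by
        by_contra! h
        nlinarith [sq_nonneg b']
      obtain ⟨p, q, r, s, h₁, h₂⟩ :=
        ih c'.toNat (by lia) c' (-b') a hc (by linarith) rfl
      refine ⟨t * p - r, t * q - s, p, q, by linear_combination h₁, ?_⟩
      have hval : a * (t * p - r) ^ 2 + 2 * b * (t * p - r) * p + c * p ^ 2 =
          c' * p ^ 2 + 2 * -b' * p * r + a * r ^ 2 := by
        rw [hb', hc']; ring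
      rw [hval, ← hdet, mul_comm a c', ← neg_sq b']
      exact h₂

/-- A positive definite integral binary form with determinant `1` only takes values which are
sums of two squares. -/
theorem exists_sq_add_sq_eq_binary (a b c : ℤ) (ha : 0 < a) (hD : a * c - b ^ 2 = 1) (x y : ℤ) :
    ∃ u v : ℤ, u ^ 2 + v ^ 2 = a * x ^ 2 + 2 * b * x * y + c * y ^ 2 := by
  obtain ⟨p, q, r, s, h₁, hpos, h₂⟩ := exists_binary_value_sq_le a b c ha (by lia)
  set m := a * p ^ 2 + 2 * b * p * r + c * r ^ 2 with hm
  have hm1 : m = 1 := by nlinarith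
  set β := a * p * q + b * (p * s + q * r) + c * r * s with hβ
  have hγ : a * q ^ 2 + 2 * b * q * s + c * s ^ 2 = 1 + β ^ 2 := by
    have : m * (a * q ^ 2 + 2 * b * q * s + c * s ^ 2) - β ^ 2 = 1 := by
      rw [hm, hβ]
      linear_combination (p * s - q * r) ^ 2 * hD + (p * s - q * r + 1) * h₁
    rw [hm1] at this
    linarith
  refine ⟨(s * x - q * y) + β * (p * y - r * x), p * y - r * x, ?_⟩
  have hx : p * (s * x - q * y) + q * (p * y - r * x) = x := by linear_combination x * h₁
  have hy : r * (s * x - q * y) + s * (p * y - r * x) = y := by linear_combination y * h₁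
  generalize s * x - q * y = X at *
  generalize p * y - r * x = Y at *
  rw [← hx, ← hy]
  linear_combination -X ^ 2 * (hm.symm.trans hm1) - Y ^ 2 * hγ + 2 * X * Y * hβ

/-- A positive definite integral ternary form with determinant `1` only takes values which are
sums of three squares. -/
theorem exists_sum_three_sq_eq_ternary (a b c d e f : ℤ) (ha : 0 < a) (hab : 0 < a * b - f ^ 2)
    (hD : a * b * c + 2 * d * e * f - a * d ^ 2 - b * e ^ 2 - c * f ^ 2 = 1) (x y z : ℤ) :
    ∃ u v w : ℤ, u ^ 2 + v ^ 2 + w ^ 2 =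
      a * x ^ 2 + b * y ^ 2 + c * z ^ 2 + 2 * d * y * z + 2 * e * x * z + 2 * f * x * y := by
  induction hk : a.toNat using Nat.strong_induction_on generalizing a b c d e f x y z with
  | _ k ih =>
    have hK : (a * b - f ^ 2) * (a * c - e ^ 2) - (a * d - e * f) ^ 2 = a := by
      linear_combination a * hD
    rcases eq_or_ne a 1 with rfl | ha1
    · obtain ⟨u, v, huv⟩ := exists_sq_add_sq_eq_binary _ _ _ hab hK y z
      exact ⟨x + f * y + e * z, u, v, by linear_combination huv⟩
    · obtain ⟨p, q, r, s, h₁, hpos, h₂⟩ := exists_binary_value_sq_le _ _ _ hab (hK.symm ▸ ha)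
      rw [hK] at h₂
      obtain ⟨t, ht⟩ := Int.exists_abs_two_mul_add_mul_le ha (f * p + e * r)
      set A := (a * b - f ^ 2) * p ^ 2 + 2 * (a * d - e * f) * p * r + (a * c - e ^ 2) * r ^ 2
        with hA
      set f' := f * p + e * r + a * t with hf'
      set b' := b * p ^ 2 + 2 * d * p * r + c * r ^ 2 + 2 * (f * p + e * r) * t + a * t ^ 2
        with hb'
      have hab' : a * b' - f' ^ 2 = A := by rw [hA, hf', hb']; ring
      have hsq : 4 * f' ^ 2 ≤ a ^ 2 := by
        have := sq_le_sq' (abs_le.mp ht).1 (abs_le.mp ht).2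
        linarith
      have hb'pos : 0 < b' := by
        refine pos_of_mul_pos_right (b := b') ?_ ha.le
        linarith [sq_nonneg f']
      have hlt : b' < a := by
        by_contra! h
        have h2 : 2 ≤ a := by lia
        have h3 : a * a ≤ a * b' := mul_le_mul_of_nonneg_left h ha.le
        have h4 : 2 * a ≤ a * a := mul_le_mul_of_nonneg_right h2 ha.le
        have h5 : 3 * A ≤ A * A := mul_le_mul_of_nonneg_right (by linarith) hpos.le
        linarith
      obtain ⟨u, v, w, huvw⟩ := ih b'.toNat (by lia) b' a
        (b * q ^ 2 + 2 * d * q * s + c * s ^ 2) (f * q + e * s)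
        (b * p * q + d * (p * s + q * r) + c * r * s + t * (f * q + e * s)) f'
        hb'pos (by linarith)
        (by
          rw [hf', hb']
          linear_combination (p * s - q * r) ^ 2 * hD + (p * s - q * r + 1) * h₁)
        (s * y - q * z) (x - t * (s * y - q * z)) (p * z - r * y) rfl
      refine ⟨u, v, w, huvw.trans ?_⟩
      have hy : p * (s * y - q * z) + q * (p * z - r * y) = y := by linear_combination y * h₁
      have hz : r * (s * y - q * z) + s * (p * z - r * y) = z := by linear_combination z * h₁
      generalize s * y - q * z = Y at *
      generalize p * z - r * y = Z at *
      rw [← hy, ← hz, hf', hb']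
      ring

/-- If `-b` is a square modulo `b n - 1`, then `n` is a sum of three squares. -/
theorem exists_sum_three_sq_of_dvd {n b : ℤ} (hb : 0 < b) (hbn : 0 < b * n - 1) {t : ℤ}
    (h : b * n - 1 ∣ t ^ 2 + b) : ∃ x y z : ℤ, x ^ 2 + y ^ 2 + z ^ 2 = n := by
  obtain ⟨a, ha⟩ := h
  have hapos : 0 < a := by
    refine pos_of_mul_pos_right (b := a) ?_ hbn.le
    rw [← ha]
    positivity
  obtain ⟨u, v, w, h⟩ := exists_sum_three_sq_eq_ternary a (b * n - 1) n 0 1 t hapos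
    (by linarith) (by linear_combination -n * ha) 0 0 1
  exact ⟨u, v, w, by linear_combination h⟩

/-- If the Jacobi symbol `J(a | p)` at a prime is `1`, then `a` is an integer square modulo `p`. -/
theorem exists_dvd_sq_sub_of_jacobiSym_eq_one {p : ℕ} (hp : p.Prime) {a : ℤ} (h : J(a | p) = 1) :
    ∃ t : ℤ, (p : ℤ) ∣ t ^ 2 - a := by
  have := Fact.mk hp
  obtain ⟨r, hr⟩ := ZMod.isSquare_of_jacobiSym_eq_one h
  obtain ⟨t, rfl⟩ := ZMod.intCast_surjective r
  refine ⟨t, (ZMod.intCast_zmod_eq_zero_iff_dvd _ _).mp ?_⟩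
  push_cast
  rw [hr]
  ring

theorem exists_sum_three_sq_of_mod_four_eq_two {n : ℕ} (hn : n % 4 = 2) :
    ∃ x y z : ℤ, x ^ 2 + y ^ 2 + z ^ 2 = (n : ℤ) := by
  have hcop : (n - 1).Coprime (4 * n) := by
    refine Nat.Coprime.mul_right ?_ ?_
    · exact Nat.Coprime.pow_right (m := 2) 2 (Nat.coprime_two_right.mpr (Nat.odd_iff.mpr (by lia)))
    · exact (Nat.coprime_self_sub_left (by lia)).mpr (Nat.coprime_one_left n)
  obtain ⟨p, hpn, hp, hmod⟩ := Nat.forall_exists_prime_gt_and_modEq (n - 1) (by lia) hcop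
  obtain ⟨v, hv⟩ := (Nat.modEq_iff_dvd' hpn.le).mp hmod.symm
  set b := 4 * v + 1 with hb
  have hpb : p + 1 = b * n := by
    have : p = n - 1 + 4 * n * v := by lia
    rw [this, hb]
    have : n - 1 + 1 = n := by lia
    linear_combination this
  have hp4 : p % 4 = 1 := by
    have : p = n - 1 + 4 * (n * v) := by rw [← mul_assoc]; lia
    lia
  have hpodd : Odd p := Nat.odd_iff.mpr (by lia)
  have hbodd : Odd b := Nat.odd_iff.mpr (by lia)
  have hJ : J(-(b : ℤ) | p) = 1 := by
    rw [jacobiSym.neg _ hpodd, ZMod.χ₄_nat_one_mod_four hp4, one_mul,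
      jacobiSym.quadratic_reciprocity_one_mod_four (by lia) hpodd,
      jacobiSym.mod_left' (a₂ := -1), jacobiSym.at_neg_one hbodd,
      ZMod.χ₄_nat_one_mod_four (by lia)]
    refine Int.ModEq.symm (Int.modEq_iff_dvd.mpr ⟨n, ?_⟩)
    zify at hpb
    linear_combination hpb
  obtain ⟨t, ht⟩ := exists_dvd_sq_sub_of_jacobiSym_eq_one hp hJ
  have hpz : (b : ℤ) * n - 1 = p := by zify at hpb; linear_combination -hpb
  exact exists_sum_three_sq_of_dvd (b := b) (t := t) (by lia)
    (by rw [hpz]; exact_mod_cast hp.pos) (by rwa [hpz, ← sub_neg_eq_add])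

/-- Here `c` is an auxiliary residue: `b = 8 v + c` and `2 p = b n - 1` with `p` prime. -/
theorem exists_sum_three_sq_of_odd {n c : ℕ}
    (h : n % 8 = 1 ∧ c = 3 ∨ n % 8 = 3 ∧ c = 1 ∨ n % 8 = 5 ∧ c = 3) :
    ∃ x y z : ℤ, x ^ 2 + y ^ 2 + z ^ 2 = (n : ℤ) := by
  obtain ⟨m, hm⟩ : ∃ m, c * n = 2 * m + 1 := ⟨c * n / 2, by
    rcases h with ⟨h, rfl⟩ | ⟨h, rfl⟩ | ⟨h, rfl⟩ <;> lia⟩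
  have hm4 : n % 8 = 5 ∧ m % 4 = 3 ∨ n % 8 ≠ 5 ∧ m % 4 = 1 := by
    rcases h with ⟨h, rfl⟩ | ⟨h, rfl⟩ | ⟨h, rfl⟩ <;> lia
  have hcop : m.Coprime (4 * n) := by
    refine Nat.Coprime.mul_right ?_ ?_
    · exact Nat.Coprime.pow_right (m := 2) 2
        (Nat.coprime_two_right.mpr (Nat.odd_iff.mpr (by lia)))
    · rw [← Nat.isCoprime_iff_coprime]
      exact ⟨-2, c, by zify at hm; linear_combination hm⟩
  obtain ⟨p, hpn, hp, hmod⟩ := Nat.forall_exists_prime_gt_and_modEq m (by lia) hcop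
  obtain ⟨v, hv⟩ := (Nat.modEq_iff_dvd' hpn.le).mp hmod.symm
  set b := 8 * v + c with hb
  have hpv : p = m + 4 * (n * v) := by rw [← mul_assoc]; lia
  have hpb : 2 * p + 1 = b * n := by
    rw [hpv, hb]
    linear_combination -hm
  have hpodd : Odd p := Nat.odd_iff.mpr (by lia)
  have hbodd : Odd b := Nat.odd_iff.mpr (by lia)
  have hJp : J(2 | b) * J(p | b) = J(-1 | b) := by
    rw [← jacobiSym.mul_left]
    refine jacobiSym.mod_left' (Int.ModEq.symm (Int.modEq_iff_dvd.mpr ⟨n, ?_⟩))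
    zify at hpb
    linear_combination hpb
  rw [jacobiSym.at_two hbodd, jacobiSym.at_neg_one hbodd, ZMod.χ₈_nat_eq_if_mod_eight,
    ZMod.χ₄_nat_eq_if_mod_four] at hJp
  have hJ : J(-(b : ℤ) | p) = 1 := by
    rw [jacobiSym.neg _ hpodd, ZMod.χ₄_nat_eq_if_mod_four,
      ← jacobiSym.quadratic_reciprocity_if (Nat.odd_iff.mp hbodd) (Nat.odd_iff.mp hpodd)]
    grind
  obtain ⟨t, ht⟩ := exists_dvd_sq_sub_of_jacobiSym_eq_one hp hJ
  obtain ⟨t, htodd, ht⟩ : ∃ t : ℤ, t % 2 = 1 ∧ (p : ℤ) ∣ t ^ 2 + b := by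
    rw [sub_neg_eq_add] at ht
    rcases Int.emod_two_eq_zero_or_one t with h0 | h1
    · refine ⟨t + p, by have := Nat.odd_iff.mp hpodd; lia, ?_⟩
      rw [show (t + p) ^ 2 + (b : ℤ) = t ^ 2 + b + p * (2 * t + p) by ring]
      exact dvd_add ht (dvd_mul_right _ _)
    · exact ⟨t, h1, ht⟩
  have hpz : (b : ℤ) * n - 1 = 2 * p := by zify at hpb; linear_combination -hpb
  refine exists_sum_three_sq_of_dvd (b := b) (t := t) (by lia)
    (by rw [hpz]; have := hp.pos; lia) ?_
  rw [hpz]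
  refine IsCoprime.mul_dvd ?_ ?_ ht
  · exact_mod_cast (Nat.coprime_two_left.mpr hpodd).isCoprime
  · refine (Int.even_iff.mpr ?_).two_dvd
    have := Nat.odd_iff.mp hbodd
    rw [Int.add_emod, pow_two, Int.mul_emod, htodd]
    lia

/-- A sum of three squares divisible by `4` is `4` times a sum of three squares. -/
theorem exists_sum_three_sq_of_four_mul {m : ℤ}
    (h : ∃ x y z : ℤ, x ^ 2 + y ^ 2 + z ^ 2 = 4 * m) : ∃ x y z : ℤ, x ^ 2 + y ^ 2 + z ^ 2 = m := by
  obtain ⟨x, y, z, h⟩ := h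
  obtain ⟨a, rfl | rfl⟩ := Int.even_or_odd' x <;> obtain ⟨b, rfl | rfl⟩ := Int.even_or_odd' y <;>
    obtain ⟨c, rfl | rfl⟩ := Int.even_or_odd' z <;> ring_nf at h <;> try lia
  exact ⟨a, b, c, by linarith⟩

theorem sum_three_sq_emod_eight_ne_seven (x y z : ℤ) : (x ^ 2 + y ^ 2 + z ^ 2) % 8 ≠ 7 := by
  have key : ∀ t : ℤ, t ^ 2 % 8 = 0 ∨ t ^ 2 % 8 = 1 ∨ t ^ 2 % 8 = 4 := by
    intro t
    have : t % 8 = 0 ∨ t % 8 = 1 ∨ t % 8 = 2 ∨ t % 8 = 3 ∨ t % 8 = 4 ∨ t % 8 = 5 ∨ t % 8 = 6 ∨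
      t % 8 = 7 := by lia
    rcases this with h | h | h | h | h | h | h | h <;> simp [pow_two, Int.mul_emod, h]
  have := key x
  have := key y
  have := key z
  lia

theorem stmt_4 (n : ℕ) (hn : 0 < n) :
    (¬ ∃ x y z : ℤ, x ^ 2 + y ^ 2 + z ^ 2 = (n : ℤ)) ↔
      ∃ e u : ℕ, Even e ∧ u % 8 = 7 ∧ n = 2 ^ e * u := by
  constructor
  · intro h
    induction n using Nat.strong_induction_on with
    | _ n ih =>
      by_cases h4 : 4 ∣ n
      · obtain ⟨m, rfl⟩ := h4
        obtain ⟨e, u, he, hu, rfl⟩ := ih m (by lia) (by lia) fun ⟨x, y, z, hm⟩ ↦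
          h ⟨2 * x, 2 * y, 2 * z, by push_cast; linear_combination 4 * hm⟩
        exact ⟨e + 2, u, he.add even_two, hu, by ring⟩
      · refine ⟨0, n, Even.zero, ?_, by simp⟩
        by_contra h7
        refine h ?_
        by_cases h2 : n % 4 = 2
        · exact exists_sum_three_sq_of_mod_four_eq_two h2
        · exact exists_sum_three_sq_of_odd (c := if n % 8 = 3 then 1 else 3) (by split_ifs <;> lia)
  · rintro ⟨e, u, ⟨k, rfl⟩, hu, rfl⟩
    clear hn
    induction k with
    | zero =>
      rintro ⟨x, y, z, h⟩
      have := sum_three_sq_emod_eight_ne_seven x y z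
      simp only [add_zero, pow_zero, one_mul] at h
      lia
    | succ k ih =>
      rintro ⟨x, y, z, h⟩
      refine ih (exists_sum_three_sq_of_four_mul ⟨x, y, z, h.trans ?_⟩)
      push_cast
      ring
end

section
/- The quadratic form x² + y² + 2z² over ℤ represents every positive integer except those of the form 2^d·u with d odd and u ≡ 7 (mod 8). -/
open scoped NumberTheorySymbols

/-- Every integer `x` can be moved by a multiple of `m > 0` so that `2 * |x| ≤ m`. -/
lemma exists_balanced_residue (x : ℤ) {m : ℤ} (hm : 0 < m) :
    ∃ k : ℤ, -m ≤ 2 * (x + k * m) ∧ 2 * (x + k * m) ≤ m := by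
  refine ⟨-((2 * x + m) / (2 * m)), ?_, ?_⟩
  · have := Int.mul_ediv_self_le (x := 2 * x + m) (k := 2 * m) (by omega)
    linarith
  · have := Int.lt_mul_ediv_self_add (x := 2 * x + m) (k := 2 * m) (by omega)
    linarith

/-- A positive definite integral ternary quadratic form with even cross terms and determinant one
takes only values that are sums of three squares. -/
theorem ternary_form_eq_sum_three_squares (a b c d e f : ℤ) (ha : 0 < a) (hB : 0 < a * b - f ^ 2)
    (hdet : a * b * c + 2 * d * e * f - a * d ^ 2 - b * e ^ 2 - c * f ^ 2 = 1) (x y z : ℤ) :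
    ∃ u v w : ℤ, a * x ^ 2 + b * y ^ 2 + c * z ^ 2 + 2 * d * y * z + 2 * e * x * z + 2 * f * x * y
      = u ^ 2 + v ^ 2 + w ^ 2 := by
  obtain ⟨A, hA⟩ : ∃ A : ℕ, a.toNat = A := ⟨_, rfl⟩
  induction A using Nat.strong_induction_on generalizing a b c d e f x y z with
  | _ A ihA =>
  obtain ⟨B, hBB⟩ : ∃ B : ℕ, (a * b - f ^ 2).toNat = B := ⟨_, rfl⟩
  induction B using Nat.strong_induction_on generalizing b c d e f x y z with
  | _ B ihB =>
  -- translate `x` to make `2 * |f| ≤ a`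
  wlog hf : -a ≤ 2 * f ∧ 2 * f ≤ a generalizing b c d e f x y z
  · obtain ⟨k, hk⟩ := exists_balanced_residue f ha
    have hB' : a * (b + 2 * k * f + k ^ 2 * a) - (f + k * a) ^ 2 = a * b - f ^ 2 := by ring
    obtain ⟨u, v, w, h⟩ := this (b + 2 * k * f + k ^ 2 * a) c (d + k * e) e (f + k * a)
      (by rwa [hB']) (by linear_combination hdet) (x - k * y) y z (by rwa [hB']) hk
    exact ⟨u, v, w, by rw [← h]; ring⟩
  by_cases hab : b < a
  · have hb : 0 < b := by nlinarith [sq_nonneg f]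
    obtain ⟨u, v, w, h⟩ := ihA b.toNat (by omega) b a c e d f hb (by linarith)
      (by linear_combination hdet) y x z rfl
    exact ⟨u, v, w, by rw [← h]; ring⟩
  -- translate `y` to make `2 * |a * d - e * f| ≤ a * b - f ^ 2`
  wlog hD : -(a * b - f ^ 2) ≤ 2 * (a * d - e * f) ∧ 2 * (a * d - e * f) ≤ a * b - f ^ 2
    generalizing c d e x y z
  · obtain ⟨k, hk⟩ := exists_balanced_residue (a * d - e * f) hB
    have hD' : a * (d + k * b) - (e + k * f) * f = a * d - e * f + k * (a * b - f ^ 2) := by ring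
    obtain ⟨u, v, w, h⟩ := this (c + 2 * k * d + k ^ 2 * b) (d + k * b) (e + k * f)
      (by linear_combination hdet) x (y - k * z) z (by rwa [hD'])
    exact ⟨u, v, w, by rw [← h]; ring⟩
  have hBC : (a * b - f ^ 2) * (a * c - e ^ 2) - (a * d - e * f) ^ 2 = a := by
    linear_combination a * hdet
  have hC : 0 < a * c - e ^ 2 := by nlinarith [sq_nonneg (a * d - e * f)]
  by_cases hCB : a * c - e ^ 2 < a * b - f ^ 2
  · obtain ⟨u, v, w, h⟩ := ihB (a * c - e ^ 2).toNat (by omega) c b d f e hC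
      (by linear_combination hdet) x z y rfl
    exact ⟨u, v, w, by rw [← h]; ring⟩
  -- the form is reduced, hence equal to `(x + e * z) ^ 2 + y ^ 2 + z ^ 2`
  push Not at hab hCB
  have hBa : 3 * a ^ 2 ≤ 4 * (a * b - f ^ 2) := by nlinarith
  have haB : 3 * (a * b - f ^ 2) ^ 2 ≤ 4 * a := by
    nlinarith [mul_le_mul_of_nonneg_left hCB hB.le]
  have ha1 : a = 1 := by
    by_contra hne
    have h2 : 2 ≤ a := by omega
    have h3 : 3 * a ≤ 2 * (a * b - f ^ 2) := by nlinarith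
    nlinarith
  subst ha1
  have hf0 : f = 0 := by omega
  subst hf0
  have hb1 : b = 1 := by nlinarith
  subst hb1
  have hd0 : d = 0 := by omega
  subst hd0
  exact ⟨x + e * z, y, z, by linear_combination z ^ 2 * hdet⟩

/-- If `-d` is a square modulo `d * n - 1 > 0`, then `n` is a sum of three squares. -/
lemma sum_three_squares_of_sq_add_dvd {n d s : ℤ} (hd : 0 < d) (hm : 0 < d * n - 1)
    (h : d * n - 1 ∣ s ^ 2 + d) : ∃ u v w : ℤ, n = u ^ 2 + v ^ 2 + w ^ 2 := by
  obtain ⟨a, ha⟩ := h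
  have hpos : 0 < a := by nlinarith [sq_nonneg s]
  obtain ⟨u, v, w, h⟩ := ternary_form_eq_sum_three_squares a (d * n - 1) n 0 1 s hpos
    (by nlinarith) (by linear_combination (-n) * ha) 0 0 1
  exact ⟨u, v, w, by rw [← h]; ring⟩

lemma jacobiSym_neg_eq {d p : ℕ} (hd : Odd d) (hp : Odd p) (h : p % 4 = 1 ∨ d % 4 = 3) :
    J(-(d : ℤ) | p) = J((p : ℤ) | d) := by
  rw [jacobiSym.neg _ hp]
  rcases Nat.odd_mod_four_iff.mp (Nat.odd_iff.mp hp) with hp1 | hp3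
  · rw [ZMod.χ₄_nat_one_mod_four hp1, one_mul, jacobiSym.quadratic_reciprocity_one_mod_four' hd hp1]
  · have hd3 : d % 4 = 3 := by omega
    rw [ZMod.χ₄_nat_three_mod_four hp3, jacobiSym.quadratic_reciprocity_three_mod_four hd3 hp3]
    ring

lemma exists_dvd_sq_add_of_jacobiSym_eq_one {d p : ℕ} (hp : p.Prime) (h : J(-(d : ℤ) | p) = 1) :
    ∃ s : ℤ, (p : ℤ) ∣ s ^ 2 + d := by
  have := Fact.mk hp
  obtain ⟨r, hr⟩ := ZMod.isSquare_of_jacobiSym_eq_one h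
  refine ⟨r.val, (ZMod.intCast_zmod_eq_zero_iff_dvd _ p).mp ?_⟩
  push_cast at hr ⊢
  rw [ZMod.natCast_zmod_val, sq, ← hr]
  ring

lemma exists_prime_eq_mul_add {q a : ℕ} (hq : q ≠ 0) (h : a.Coprime q) :
    ∃ p j : ℕ, p.Prime ∧ p = q * j + a := by
  obtain ⟨p, hpa, hp, hmod⟩ := Nat.forall_exists_prime_gt_and_modEq a hq h
  obtain ⟨j, hj⟩ := (Nat.modEq_iff_dvd' hpa.le).mp hmod.symm
  exact ⟨p, j, hp, by omega⟩

theorem sum_three_squares_of_two_mod_four {n : ℕ} (hn : n % 4 = 2) :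
    ∃ u v w : ℤ, (n : ℤ) = u ^ 2 + v ^ 2 + w ^ 2 := by
  have hcop : (n - 1).Coprime (4 * n) := by
    refine Nat.Coprime.mul_right ?_ ?_
    · have h2 : (n - 1).Coprime 2 := Nat.coprime_two_right.mpr (Nat.odd_iff.mpr (by omega))
      exact h2.mul_right h2
    · exact (Nat.coprime_self_sub_left (by omega)).mpr (Nat.coprime_one_left n)
  obtain ⟨p, j, hp, hpj⟩ := exists_prime_eq_mul_add (by omega) hcop
  have hpd : (p : ℤ) = (4 * j + 1 : ℕ) * n - 1 := by
    rw [hpj]; push_cast [show 1 ≤ n by omega]; ring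
  have hp4 : p % 4 = 1 := by
    have : p = 4 * (n * j) + (n - 1) := by rw [hpj]; ring
    omega
  have hd : Odd (4 * j + 1) := Nat.odd_iff.mpr (by omega)
  have hJ : J(-((4 * j + 1 : ℕ) : ℤ) | p) = 1 := by
    rw [jacobiSym_neg_eq hd (Nat.odd_iff.mpr (by omega)) (Or.inl hp4),
      jacobiSym.mod_left' (a₂ := -1) (by rw [hpd, sub_eq_add_neg, Int.mul_add_emod_self_left]),
      jacobiSym.at_neg_one hd, ZMod.χ₄_nat_one_mod_four (by omega)]
  obtain ⟨s, hs⟩ := exists_dvd_sq_add_of_jacobiSym_eq_one hp hJ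
  rw [hpd] at hs
  exact sum_three_squares_of_sq_add_dvd (by positivity)
    (by rw [← hpd]; exact_mod_cast hp.pos) hs

lemma sum_three_squares_of_two_mul_add_one {n c r : ℕ} (hc : c = 1 ∨ c = 3)
    (hr : 2 * r + 1 = c * n) (hr2 : r % 2 = 1) (h : r % 4 = 1 ∨ c = 3) :
    ∃ u v w : ℤ, (n : ℤ) = u ^ 2 + v ^ 2 + w ^ 2 := by
  have hn : n ≠ 0 := by rintro rfl; omega
  have hcop : r.Coprime (4 * n) := by
    refine Nat.Coprime.mul_right ?_ ?_
    · have h2 : r.Coprime 2 := Nat.coprime_two_right.mpr (Nat.odd_iff.mpr hr2)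
      exact h2.mul_right h2
    · refine Nat.isCoprime_iff_coprime.mp ⟨-2, c, ?_⟩
      have : (2 * r + 1 : ℤ) = c * n := by exact_mod_cast hr
      linarith
  obtain ⟨p, j, hp, hpj⟩ := exists_prime_eq_mul_add (by omega) hcop
  have hpd : 2 * (p : ℤ) = (8 * j + c : ℕ) * n - 1 := by
    have : (2 * r + 1 : ℤ) = c * n := by exact_mod_cast hr
    rw [hpj]; push_cast; linear_combination this
  have hp4 : p % 4 = r % 4 := by
    have : p = 4 * (n * j) + r := by rw [hpj]; ring
    omega
  have hd : Odd (8 * j + c) := Nat.odd_iff.mpr (by omega)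
  have hneg2 : J(-2 | 8 * j + c) = 1 := by
    rw [jacobiSym.at_neg_two hd, ZMod.χ₈'_nat_eq_if_mod_eight, if_neg (by omega), if_pos (by omega)]
  have hmul : J(-2 | 8 * j + c) * J((p : ℤ) | 8 * j + c) = 1 := by
    rw [← jacobiSym.mul_left, jacobiSym.mod_left' (a₂ := 1), jacobiSym.one_left]
    rw [show -2 * (p : ℤ) = (8 * j + c : ℕ) * (-n) + 1 by linear_combination -hpd,
      Int.mul_add_emod_self_left]
  rw [hneg2, one_mul] at hmul
  have hJ : J(-((8 * j + c : ℕ) : ℤ) | p) = 1 := by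
    rw [jacobiSym_neg_eq hd (Nat.odd_iff.mpr (by omega)) (by omega), hmul]
  obtain ⟨s, hs⟩ := exists_dvd_sq_add_of_jacobiSym_eq_one hp hJ
  -- an odd square root of `-d` modulo `p` is one modulo `2 * p`
  obtain ⟨t, htodd, ht⟩ : ∃ t : ℤ, Odd t ∧ (p : ℤ) ∣ t ^ 2 + (8 * j + c : ℕ) := by
    rcases Int.even_or_odd s with hs' | hs'
    · refine ⟨s + p, hs'.add_odd ((Int.odd_coe_nat p).mpr (Nat.odd_iff.mpr (by omega))), ?_⟩
      rw [show (s + p) ^ 2 + ((8 * j + c : ℕ) : ℤ) = s ^ 2 + (8 * j + c : ℕ) + p * (2 * s + p) by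
        ring]
      exact hs.add (dvd_mul_right _ _)
    · exact ⟨s, hs', hs⟩
  have h2 : (2 : ℤ) ∣ t ^ 2 + (8 * j + c : ℕ) :=
    (htodd.pow.add_odd ((Int.odd_coe_nat _).mpr hd)).two_dvd
  have hcop2 : IsCoprime (2 : ℤ) p := by
    exact_mod_cast Nat.isCoprime_iff_coprime.mpr
      (Nat.coprime_two_left.mpr (Nat.odd_iff.mpr (by omega)))
  have hdvd := hcop2.mul_dvd h2 ht
  rw [hpd] at hdvd
  have hp0 : (0 : ℤ) < p := by exact_mod_cast hp.pos
  exact sum_three_squares_of_sq_add_dvd (by exact_mod_cast hd.pos) (by linarith) hdvd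

theorem sum_three_squares_of_odd {n : ℕ} (hn : n % 8 = 1 ∨ n % 8 = 3 ∨ n % 8 = 5) :
    ∃ u v w : ℤ, (n : ℤ) = u ^ 2 + v ^ 2 + w ^ 2 := by
  rcases hn with h | h | h
  · exact sum_three_squares_of_two_mul_add_one (c := 3) (r := (3 * n - 1) / 2)
      (by omega) (by omega) (by omega) (by omega)
  · exact sum_three_squares_of_two_mul_add_one (c := 1) (r := (n - 1) / 2)
      (by omega) (by omega) (by omega) (by omega)
  · exact sum_three_squares_of_two_mul_add_one (c := 3) (r := (3 * n - 1) / 2)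
      (by omega) (by omega) (by omega) (by omega)

/-- If `2 * n` is a sum of three squares, then `x² + y² + 2z²` represents `n`. -/
lemma represents_of_two_mul_eq {n u v w : ℤ} (h : 2 * n = u ^ 2 + v ^ 2 + w ^ 2) :
    ∃ x y z : ℤ, x ^ 2 + y ^ 2 + 2 * z ^ 2 = n := by
  wlog hw : Even w generalizing u v w
  · by_cases hu : Even u
    · exact this (by linarith : 2 * n = v ^ 2 + w ^ 2 + u ^ 2) hu
    · refine this (by linarith : 2 * n = w ^ 2 + u ^ 2 + v ^ 2) ?_
      have h2 : Even (u ^ 2 + v ^ 2 + w ^ 2) := h ▸ even_two_mul n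
      simp only [Int.even_add, Int.even_pow' two_ne_zero] at h2
      tauto
  have huv : Even (u + v) := by
    have h2 : Even (u ^ 2 + v ^ 2 + w ^ 2) := h ▸ even_two_mul n
    simp only [Int.even_add, Int.even_pow' two_ne_zero] at h2 ⊢
    tauto
  obtain ⟨k, hk⟩ := hw
  obtain ⟨l, hl⟩ := huv
  refine ⟨l, l - v, k, ?_⟩
  obtain rfl : u = l + l - v := by linarith
  subst hk
  linarith

theorem represents_of_not_exceptional (n : ℕ) (hn : 0 < n)
    (h : ¬ ∃ d u : ℕ, Odd d ∧ u % 8 = 7 ∧ n = 2 ^ d * u) :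
    ∃ x y z : ℤ, x ^ 2 + y ^ 2 + 2 * z ^ 2 = (n : ℤ) := by
  induction n using Nat.strong_induction_on with
  | _ n ih =>
  by_cases h4 : n % 4 = 0
  · obtain ⟨m, rfl⟩ := Nat.dvd_of_mod_eq_zero h4
    obtain ⟨x, y, z, hxyz⟩ := ih m (by omega) (by omega) (by
      rintro ⟨d, u, hd, hu, rfl⟩
      exact h ⟨d + 2, u, hd.add_even even_two, hu, by ring⟩)
    exact ⟨2 * x, 2 * y, 2 * z, by push_cast; linear_combination 4 * hxyz⟩
  by_cases h2 : n % 4 = 2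
  · obtain ⟨m, rfl⟩ : ∃ m, n = 2 * m := ⟨n / 2, by omega⟩
    have hm : m % 8 ≠ 7 := fun hm => h ⟨1, m, odd_one, hm, by ring⟩
    obtain ⟨u, v, w, huvw⟩ := sum_three_squares_of_odd (n := m) (by omega)
    exact ⟨u + v, u - v, w, by push_cast; linear_combination -2 * huvw⟩
  · obtain ⟨u, v, w, huvw⟩ := sum_three_squares_of_two_mod_four (n := 2 * n) (by omega)
    push_cast at huvw
    exact represents_of_two_mul_eq huvw

lemma not_represents_of_mod_sixteen_eq {n : ℤ} (hn : n % 16 = 14) (x y z : ℤ) :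
    x ^ 2 + y ^ 2 + 2 * z ^ 2 ≠ n := by
  rintro rfl
  have key : ∀ a b c : ZMod 16, a ^ 2 + b ^ 2 + 2 * c ^ 2 ≠ 14 := by decide
  apply key x y z
  have := (ZMod.intCast_eq_intCast_iff' (x ^ 2 + y ^ 2 + 2 * z ^ 2) 14 16).mpr (by simpa using hn)
  exact_mod_cast this

lemma even_of_eight_dvd {x y z : ℤ} (h : 8 ∣ x ^ 2 + y ^ 2 + 2 * z ^ 2) :
    2 ∣ x ∧ 2 ∣ y ∧ 2 ∣ z := by
  have key : ∀ a b c : ZMod 8, a ^ 2 + b ^ 2 + 2 * c ^ 2 = 0 → 4 * a = 0 ∧ 4 * b = 0 ∧ 4 * c = 0 := by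
    decide
  have even_of (t : ℤ) (ht : 4 * (t : ZMod 8) = 0) : 2 ∣ t := by
    have : (8 : ℤ) ∣ 4 * t := (ZMod.intCast_zmod_eq_zero_iff_dvd _ 8).mp (by exact_mod_cast ht)
    omega
  have h0 := (ZMod.intCast_zmod_eq_zero_iff_dvd (x ^ 2 + y ^ 2 + 2 * z ^ 2) 8).mpr h
  obtain ⟨hx, hy, hz⟩ := key x y z (by exact_mod_cast h0)
  exact ⟨even_of x hx, even_of y hy, even_of z hz⟩

theorem not_represents_exceptional (k : ℕ) {u : ℤ} (hu : u % 8 = 7) (x y z : ℤ) :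
    x ^ 2 + y ^ 2 + 2 * z ^ 2 ≠ 2 ^ (2 * k + 1) * u := by
  induction k generalizing x y z with
  | zero => exact not_represents_of_mod_sixteen_eq (by omega) x y z
  | succ k ih =>
    intro h
    obtain ⟨⟨x, rfl⟩, ⟨y, rfl⟩, ⟨z, rfl⟩⟩ := even_of_eight_dvd (x := x) (y := y) (z := z)
      ⟨2 ^ (2 * k) * u, by rw [h]; ring⟩
    refine ih x y z ?_
    have : 4 * (x ^ 2 + y ^ 2 + 2 * z ^ 2) = 4 * (2 ^ (2 * k + 1) * u) := by
      linear_combination h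
    linarith

theorem stmt_5 (n : ℕ) (hn : 0 < n) :
    (¬ ∃ x y z : ℤ, x ^ 2 + y ^ 2 + 2 * z ^ 2 = (n : ℤ)) ↔
      ∃ d u : ℕ, Odd d ∧ u % 8 = 7 ∧ n = 2 ^ d * u := by
  constructor
  · intro h
    by_contra h'
    exact h (represents_of_not_exceptional n hn h')
  · rintro ⟨_, u, ⟨k, rfl⟩, hu, rfl⟩ ⟨x, y, z, h⟩
    push_cast at h
    exact not_represents_exceptional k (by omega) x y z h
end

section
/- The quadratic form x² + 2y² + 5z² over ℤ represents every positive integer except those of the form 5^d·u with d odd and u a quadratic nonresidue modulo 5. -/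
/-- The ternary quadratic form with symmetric matrix `!![a, t, s; t, b, r; s, r, c]`. -/
def ternaryForm (a b c r s t x y z : ℤ) : ℤ :=
  a * x ^ 2 + b * y ^ 2 + c * z ^ 2 + 2 * r * y * z + 2 * s * x * z + 2 * t * x * y

/-- `S` is the set of integers represented by the ternary form. -/
def IsValueSet (S : Set ℤ) (a b c r s t : ℤ) : Prop :=
  ∀ m, m ∈ S ↔ ∃ x y z, ternaryForm a b c r s t x y z = m

lemma exists_abs_two_mul_add_mul_le (h : ℤ) {g : ℤ} (hg : 0 < g) :
    ∃ k, |2 * (h + k * g)| ≤ g := by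
  refine ⟨-((2 * h + g) / (2 * g)), ?_⟩
  have h1 := Int.emod_nonneg (2 * h + g) (by omega : 2 * g ≠ 0)
  have h2 := Int.emod_lt_of_pos (2 * h + g) (by omega : 0 < 2 * g)
  have h3 := Int.emod_add_mul_ediv (2 * h + g) (2 * g)
  rw [abs_le]
  constructor <;> nlinarith

lemma IsValueSet.swap_left {S : Set ℤ} {a b c r s t : ℤ} (h : IsValueSet S a b c r s t) :
    IsValueSet S b a c s r t := by
  intro m
  rw [h m]
  constructor <;> rintro ⟨x, y, z, rfl⟩ <;> exact ⟨y, x, z, by unfold ternaryForm; ring⟩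

lemma IsValueSet.swap_right {S : Set ℤ} {a b c r s t : ℤ} (h : IsValueSet S a b c r s t) :
    IsValueSet S a c b r t s := by
  intro m
  rw [h m]
  constructor <;> rintro ⟨x, y, z, rfl⟩ <;> exact ⟨x, z, y, by unfold ternaryForm; ring⟩

lemma IsValueSet.shear {S : Set ℤ} {a b c r s t : ℤ} (h : IsValueSet S a b c r s t)
    (i j k : ℤ) :
    IsValueSet S a (a * i ^ 2 + 2 * t * i + b) (ternaryForm a b c r s t j k 1)
      (a * i * j + t * (i * k + j) + s * i + b * k + r) (s + k * t + j * a) (t + i * a) := by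
  intro m
  rw [h m]
  constructor
  · rintro ⟨x, y, z, rfl⟩
    exact ⟨x - i * (y - k * z) - j * z, y - k * z, z, by unfold ternaryForm; ring⟩
  · rintro ⟨x, y, z, rfl⟩
    exact ⟨x + i * y + j * z, y + k * z, z, by unfold ternaryForm; ring⟩

lemma IsValueSet.exists_reduced {S : Set ℤ} {a b c r s t : ℤ} (h : IsValueSet S a b c r s t)
    (ha : 0 < a) (hg : 0 < a * b - t ^ 2)
    (hdet : (a * b - t ^ 2) * (a * c - s ^ 2) - (a * r - s * t) ^ 2 = 10 * a) :
    ∃ b' c' r' s' t', IsValueSet S a b' c' r' s' t' ∧ a * b' - t' ^ 2 = a * b - t ^ 2 ∧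
      (a * b' - t' ^ 2) * (a * c' - s' ^ 2) - (a * r' - s' * t') ^ 2 = 10 * a ∧
      |2 * t'| ≤ a ∧ |2 * s'| ≤ a ∧ |2 * (a * r' - s' * t')| ≤ a * b' - t' ^ 2 := by
  obtain ⟨k, hk⟩ := exists_abs_two_mul_add_mul_le (a * r - s * t) hg
  obtain ⟨i, hi⟩ := exists_abs_two_mul_add_mul_le t ha
  obtain ⟨j, hj⟩ := exists_abs_two_mul_add_mul_le (s + k * t) ha
  refine ⟨_, _, _, _, _, h.shear i j k, by ring, ?_, hi, hj, ?_⟩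
  · rw [← hdet]; unfold ternaryForm; ring
  · convert hk using 1
    · congr 1; ring
    · ring

lemma eq_of_reduced {S : Set ℤ} (hodd : ∃ m ∈ S, Odd m)
    (h25 : ∀ m ∈ S, m % 25 ≠ 10 ∧ m % 25 ≠ 15) {a b c r s t : ℤ}
    (h : IsValueSet S a b c r s t) (ha : 0 < a)
    (hdet : (a * b - t ^ 2) * (a * c - s ^ 2) - (a * r - s * t) ^ 2 = 10 * a)
    (ht : |2 * t| ≤ a) (hs : |2 * s| ≤ a) (hr : |2 * (a * r - s * t)| ≤ a * b - t ^ 2)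
    (hab : a ≤ b) (hbc : a * b - t ^ 2 ≤ a * c - s ^ 2) :
    a = 1 ∧ b = 2 ∧ c = 5 ∧ r = 0 ∧ s = 0 ∧ t = 0 := by
  have heven : ¬ (a % 2 = 0 ∧ b % 2 = 0 ∧ c % 2 = 0) := by
    rintro ⟨ha', hb', hc'⟩
    obtain ⟨a', rfl⟩ := Int.even_iff.2 ha'
    obtain ⟨b', rfl⟩ := Int.even_iff.2 hb'
    obtain ⟨c', rfl⟩ := Int.even_iff.2 hc'
    obtain ⟨m, hm, hm'⟩ := hodd
    obtain ⟨x, y, z, rfl⟩ := (h m).1 hm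
    rw [← Int.not_even_iff_odd] at hm'
    apply hm'
    exact ⟨a' * x ^ 2 + b' * y ^ 2 + c' * z ^ 2 + r * y * z + s * x * z + t * x * y,
      by unfold ternaryForm; ring⟩
  have hval : ∀ x y z, ternaryForm a b c r s t x y z ≠ 10 := fun x y z e =>
    (h25 10 ((h 10).2 ⟨x, y, z, e⟩)).1 (by norm_num)
  unfold ternaryForm at hval
  rw [abs_le] at ht hs hr
  obtain ⟨ht1, ht2⟩ := ht
  obtain ⟨hs1, hs2⟩ := hs
  obtain ⟨hr1, hr2⟩ := hr
  have ht4 : 4 * t ^ 2 ≤ a ^ 2 := by nlinarith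
  have hg : 3 * a ^ 2 ≤ 4 * (a * b - t ^ 2) := by nlinarith
  have hr4 : 4 * (a * r - s * t) ^ 2 ≤ (a * b - t ^ 2) ^ 2 := by nlinarith
  have hg2 : 3 * (a * b - t ^ 2) ^ 2 ≤ 40 * a := by nlinarith
  have ha2 : a ≤ 2 := by
    by_contra! h3
    have : (3 * a ^ 2) ^ 2 ≤ (4 * (a * b - t ^ 2)) ^ 2 := by gcongr
    have h4 : 27 * a ^ 3 * a ≤ 640 * a := by nlinarith
    have h5 := le_of_mul_le_mul_right h4 ha
    nlinarith [pow_le_pow_left₀ (by norm_num : (0:ℤ) ≤ 3) h3 3]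
  have ht3 : -1 ≤ t ∧ t ≤ 1 := by omega
  have hs3 : -1 ≤ s ∧ s ≤ 1 := by omega
  obtain ⟨ht3, ht3'⟩ := ht3
  obtain ⟨hs3, hs3'⟩ := hs3
  have hg5 : a * b - t ^ 2 ≤ 5 := by nlinarith
  have v1 := hval 0 0 1
  have v2 := hval 1 1 0
  have v3 := hval 2 1 0
  have v4 := hval 1 2 0
  have v5 := hval 1 (-2) 0
  clear hval h25 h
  obtain rfl | rfl : a = 1 ∨ a = 2 := by omega
  · obtain rfl : t = 0 := by omega
    obtain rfl : s = 0 := by omega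
    have hb : b ≤ 3 := by nlinarith
    have hb' : r ≤ 1 := by omega
    have hb'' : -1 ≤ r := by omega
    interval_cases b <;> interval_cases r <;> omega
  · have hb : b ≤ 3 := by nlinarith
    exfalso
    interval_cases t <;> interval_cases s <;> interval_cases b <;> try omega
    all_goals
      have hr5 : -2 ≤ r := by omega
      have hr5' : r ≤ 2 := by omega
      interval_cases r <;> omega

theorem represented_of_isValueSet {S : Set ℤ} (hodd : ∃ m ∈ S, Odd m)
    (h25 : ∀ m ∈ S, m % 25 ≠ 10 ∧ m % 25 ≠ 15) (a b c r s t : ℤ)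
    (h : IsValueSet S a b c r s t) (ha : 0 < a) (hg : 0 < a * b - t ^ 2)
    (hdet : (a * b - t ^ 2) * (a * c - s ^ 2) - (a * r - s * t) ^ 2 = 10 * a)
    (m : ℤ) (hm : m ∈ S) : ∃ x y z : ℤ, x ^ 2 + 2 * y ^ 2 + 5 * z ^ 2 = m := by
  obtain ⟨b', c', r', s', t', h', hg', hdet', ht, hs, hr⟩ := h.exists_reduced ha hg hdet
  have hdet3 : a * b' * c' + 2 * r' * s' * t' - a * r' ^ 2 - b' * s' ^ 2 - c' * t' ^ 2 = 10 :=
    mul_left_cancel₀ ha.ne' (by linear_combination hdet')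
  have hb' : 0 < b' := by
    have : 0 < a * b' := by nlinarith [sq_nonneg t']
    exact pos_of_mul_pos_right this ha.le
  by_cases hba : b' < a
  · exact represented_of_isValueSet hodd h25 b' a c' s' r' t' h'.swap_left hb' (by linarith)
      (by linear_combination b' * hdet3) m hm
  by_cases hcb : a * c' - s' ^ 2 < a * b' - t' ^ 2
  · have hc : 0 < a * c' - s' ^ 2 := by
      have : 0 < (a * b' - t' ^ 2) * (a * c' - s' ^ 2) := by
        nlinarith [sq_nonneg (a * r' - s' * t')]
      exact pos_of_mul_pos_right this (by omega)
    exact represented_of_isValueSet hodd h25 a c' b' r' t' s' h'.swap_right ha hc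
      (by linear_combination hdet') m hm
  · obtain ⟨rfl, rfl, rfl, rfl, rfl, rfl⟩ := eq_of_reduced hodd h25 h' ha hdet' ht hs hr
      (not_lt.1 hba) (not_lt.1 hcb)
    obtain ⟨x, y, z, e⟩ := (h' m).1 hm
    exact ⟨x, y, z, by rw [← e]; unfold ternaryForm; ring⟩
termination_by (a.toNat, (a * b - t ^ 2).toNat)
decreasing_by
  · apply Prod.Lex.left
    omega
  · apply Prod.Lex.right
    omega

lemma five_dvd_of_dvd_sq_add {d u y : ℤ} (hd : d % 5 = 2 ∨ d % 5 = 3)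
    (h : (5 : ℤ) ∣ u ^ 2 + d * y ^ 2) : (5 : ℤ) ∣ y := by
  rw [Int.dvd_iff_emod_eq_zero] at *
  have hu : u % 5 = 0 ∨ u % 5 = 1 ∨ u % 5 = 2 ∨ u % 5 = 3 ∨ u % 5 = 4 := by omega
  have hy : y % 5 = 0 ∨ y % 5 = 1 ∨ y % 5 = 2 ∨ y % 5 = 3 ∨ y % 5 = 4 := by omega
  rcases hd with hd | hd <;> rcases hu with hu | hu | hu | hu | hu <;>
    rcases hy with hy | hy | hy | hy | hy <;>
    simp [Int.add_emod, Int.mul_emod, pow_two, hd, hu, hy] at h ⊢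

lemma ternaryForm_emod_ne {a b n t τ d : ℤ} (hab : a * b = t ^ 2 + d)
    (hd : d % 5 = 2 ∨ d % 5 = 3) (hn : n * d = τ ^ 2 * b + 10) (x y z : ℤ) :
    ternaryForm a b n 0 τ t x y z % 25 ≠ 10 ∧ ternaryForm a b n 0 τ t x y z % 25 ≠ 15 := by
  set m := ternaryForm a b n 0 τ t x y z with hm
  unfold ternaryForm at hm
  set X := d * x + τ * b * z with hX
  set Y := d * y - τ * t * z with hY
  have key : d ^ 2 * m = a * X ^ 2 + 2 * t * X * Y + b * Y ^ 2 + 10 * d * z ^ 2 := by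
    rw [hm, hX, hY]
    linear_combination (-2 * τ * d * x * z - τ ^ 2 * b * z ^ 2) * hab + d * z ^ 2 * hn
  have main : (5 : ℤ) ∣ m → (5 : ℤ) ∣ X ∧ (5 : ℤ) ∣ Y := by
    intro h5
    have h : (5 : ℤ) ∣ a * X ^ 2 + 2 * t * X * Y + b * Y ^ 2 := by
      have : a * X ^ 2 + 2 * t * X * Y + b * Y ^ 2 = d ^ 2 * m - 5 * (2 * d * z ^ 2) := by
        linear_combination -key
      rw [this]
      exact dvd_sub (h5.mul_left _) (dvd_mul_right _ _)
    constructor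
    · apply five_dvd_of_dvd_sq_add (u := b * Y + t * X) hd
      have e : (b * Y + t * X) ^ 2 + d * X ^ 2 =
          b * (a * X ^ 2 + 2 * t * X * Y + b * Y ^ 2) := by
        linear_combination -X ^ 2 * hab
      exact e ▸ h.mul_left b
    · apply five_dvd_of_dvd_sq_add (u := a * X + t * Y) hd
      have e : (a * X + t * Y) ^ 2 + d * Y ^ 2 =
          a * (a * X ^ 2 + 2 * t * X * Y + b * Y ^ 2) := by
        linear_combination -Y ^ 2 * hab
      exact e ▸ h.mul_left a
  suffices H : ∀ q, m ≠ 25 * q + 10 ∧ m ≠ 25 * q + 15 by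
    have := H (m / 25)
    omega
  intro q
  rw [← not_or]
  intro hq
  obtain ⟨⟨X', hX'⟩, ⟨Y', hY'⟩⟩ := main (by omega)
  rw [hX', hY'] at key
  have hz : z % 5 = 0 ∨ z % 5 = 1 ∨ z % 5 = 2 ∨ z % 5 = 3 ∨ z % 5 = 4 := by omega
  have h1 : (2 * d * d - 2 * d * z * z) % 5 = 0 ∨ (3 * d * d - 2 * d * z * z) % 5 = 0 := by
    rcases hq with hq | hq
    · left
      apply Int.emod_eq_zero_of_dvd
      refine ⟨a * X' ^ 2 + 2 * t * X' * Y' + b * Y' ^ 2 - d ^ 2 * q, ?_⟩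
      rw [hq] at key
      linarith
    · right
      apply Int.emod_eq_zero_of_dvd
      refine ⟨a * X' ^ 2 + 2 * t * X' * Y' + b * Y' ^ 2 - d ^ 2 * q, ?_⟩
      rw [hq] at key
      linarith
  rcases hd with hd | hd <;> rcases hz with hz | hz | hz | hz | hz <;>
    simp [Int.sub_emod, Int.mul_emod, hd, hz] at h1

lemma represented_of_adjoint {a b n t τ d : ℤ} (hb : 0 < b) (hd0 : 0 < d)
    (hab : a * b = t ^ 2 + d) (hd : d % 5 = 2 ∨ d % 5 = 3) (hn : n * d = τ ^ 2 * b + 10)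
    (hodd : Odd a ∨ Odd b) : ∃ x y z : ℤ, x ^ 2 + 2 * y ^ 2 + 5 * z ^ 2 = n := by
  have ha : 0 < a := by
    have : 0 < a * b := by nlinarith [sq_nonneg t]
    exact pos_of_mul_pos_left this hb.le
  refine represented_of_isValueSet (S := {m | ∃ x y z, ternaryForm a b n 0 τ t x y z = m})
    ?_ ?_ a b n 0 τ t (fun m => Iff.rfl) ha (by linarith) ?_ n
    ⟨0, 0, 1, by unfold ternaryForm; ring⟩
  · rcases hodd with h | h
    · exact ⟨a, ⟨1, 0, 0, by unfold ternaryForm; ring⟩, h⟩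
    · exact ⟨b, ⟨0, 1, 0, by unfold ternaryForm; ring⟩, h⟩
  · rintro _ ⟨x, y, z, rfl⟩
    exact ternaryForm_emod_ne hab hd hn x y z
  · linear_combination a * n * hab + a * hn

open NumberTheorySymbols

lemma jacobiSym_eq_of_sq_mul_add {p d : ℕ} {τ c n : ℤ} (h : n * d = τ ^ 2 * p + c)
    (hc : J(-c | d) = 1) : J(p | d) = 1 := by
  have h1 : J(τ ^ 2 * p | d) = 1 := by
    rw [← hc]
    apply jacobiSym.mod_left'
    rw [show τ ^ 2 * (p : ℤ) = -c + d * n by linarith, Int.add_mul_emod_self_left]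
  rw [jacobiSym.mul_left, jacobiSym.pow_left] at h1
  rcases jacobiSym.trichotomy τ d with h2 | h2 | h2 <;> simp_all

lemma jacobiSym_five {d : ℕ} (hd : Odd d) : J(5 | d) = J((d % 5 : ℕ) | 5) := by
  rw [Int.natCast_mod, ← Nat.cast_ofNat, ← jacobiSym.mod_left]
  exact jacobiSym.quadratic_reciprocity_one_mod_four (by norm_num) hd

lemma exists_sq_add_eq_mul {p : ℕ} (hp : p.Prime) {d : ℤ} (h : J(-d | p) = 1) :
    ∃ t k : ℤ, t ^ 2 + d = k * p := by
  have := Fact.mk hp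
  obtain ⟨t, ht⟩ := ZMod.isSquare_of_jacobiSym_eq_one h
  obtain ⟨t, rfl⟩ := ZMod.intCast_surjective t
  have : ((t ^ 2 + d : ℤ) : ZMod p) = 0 := by
    push_cast at ht ⊢
    linear_combination -ht
  obtain ⟨k, hk⟩ := (ZMod.intCast_zmod_eq_zero_iff_dvd _ _).1 this
  exact ⟨t, k, by rw [hk, mul_comm]⟩

lemma represented_of_prime {n τ : ℤ} {p d : ℕ} (hp : p.Prime) (hp2 : Odd p) (hd8 : d % 8 = 7)
    (hd5 : d % 5 = 2 ∨ d % 5 = 3) (h : n * d = τ ^ 2 * p + 10) :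
    ∃ x y z : ℤ, x ^ 2 + 2 * y ^ 2 + 5 * z ^ 2 = n := by
  have hdo : Odd d := Nat.odd_iff.2 (by omega)
  have hpd : J(p | d) = 1 := by
    apply jacobiSym_eq_of_sq_mul_add h
    rw [show (-10 : ℤ) = -1 * 2 * 5 by norm_num, jacobiSym.mul_left, jacobiSym.mul_left,
      jacobiSym.at_neg_one hdo, jacobiSym.at_two hdo, jacobiSym_five hdo,
      ZMod.χ₄_nat_three_mod_four (by omega), ZMod.χ₈_nat_mod_eight, hd8,
      show ZMod.χ₈ (7 : ℕ) = 1 by decide]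
    rcases hd5 with h | h <;> rw [h] <;> norm_num
  have hdp : J(-d | p) = 1 := by
    rw [jacobiSym.neg _ hp2]
    rcases Nat.odd_mod_four_iff.1 (Nat.odd_iff.1 hp2) with h4 | h4
    · rw [jacobiSym.quadratic_reciprocity_one_mod_four' hdo h4, hpd,
        ZMod.χ₄_nat_one_mod_four h4, mul_one]
    · rw [jacobiSym.quadratic_reciprocity_three_mod_four (by omega) h4, hpd,
        ZMod.χ₄_nat_three_mod_four h4]
      norm_num
  obtain ⟨t, a, hta⟩ := exists_sq_add_eq_mul hp hdp
  exact represented_of_adjoint (b := p) (d := d) (by exact_mod_cast hp.pos) (by omega) hta.symm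
    (by omega) h (Or.inr (by exact_mod_cast hp2))

lemma represented_of_two_mul_prime {n τ : ℤ} {p d : ℕ} (hp : p.Prime) (hp8 : p % 8 = 1)
    (hd4 : d % 4 = 1) (hd5 : d % 5 = 1 ∨ d % 5 = 4) (h : n * d = τ ^ 2 * p + 5) :
    ∃ x y z : ℤ, x ^ 2 + 2 * y ^ 2 + 5 * z ^ 2 = n := by
  have hdo : Odd d := Nat.odd_iff.2 (by omega)
  have hpo : Odd p := Nat.odd_iff.2 (by omega)
  have hpd : J(p | d) = 1 := by
    apply jacobiSym_eq_of_sq_mul_add h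
    rw [jacobiSym.neg _ hdo, jacobiSym_five hdo, ZMod.χ₄_nat_one_mod_four hd4, one_mul]
    rcases hd5 with h | h <;> rw [h] <;> norm_num
  have hdp : J(-(2 * d) | p) = 1 := by
    rw [jacobiSym.neg _ hpo, jacobiSym.mul_left, jacobiSym.at_two hpo,
      jacobiSym.quadratic_reciprocity_one_mod_four hd4 hpo, hpd,
      ZMod.χ₄_nat_one_mod_four (by omega), ZMod.χ₈_nat_mod_eight, hp8]
    decide
  obtain ⟨w, k, hk⟩ : ∃ w k : ℤ, (2 * w) ^ 2 + 2 * d = k * p := by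
    obtain ⟨t, k, hk⟩ := exists_sq_add_eq_mul hp hdp
    have hpo' : Odd (p : ℤ) := by exact_mod_cast hpo
    rcases Int.even_or_odd t with ht | ht
    · obtain ⟨w, rfl⟩ := even_iff_two_dvd.1 ht
      exact ⟨w, k, hk⟩
    · obtain ⟨w, hw⟩ := even_iff_two_dvd.1 (ht.add_odd hpo')
      exact ⟨w, k + 2 * t + p, by rw [← hw]; linear_combination hk⟩
  obtain ⟨a, rfl⟩ : (2 : ℤ) ∣ k := by
    have h2 : (2 : ℤ) ∣ k * p := ⟨2 * w ^ 2 + d, by rw [← hk]; ring⟩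
    refine (Int.prime_two.dvd_or_dvd h2).resolve_right ?_
    omega
  have hap : a * p = 2 * w ^ 2 + d := by linarith
  have hao : Odd (a * p) := by
    rw [hap]
    exact (even_two_mul _).add_odd (by exact_mod_cast hdo)
  refine represented_of_adjoint (a := a) (b := 2 * p) (d := 2 * d) (t := 2 * w) (τ := τ)
    ?_ ?_ ?_ ?_ ?_ (Or.inl (Int.odd_mul.1 hao).1)
  · have := hp.pos
    omega
  · omega
  · linarith
  · omega
  · linarith

lemma exists_prime_eq_add_mul {N : ℕ} (hN : N ≠ 0) {c : ℤ} (hc : IsCoprime c N) :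
    ∃ p k : ℕ, p.Prime ∧ (p : ℤ) = c + N * k := by
  obtain ⟨p, hpc, hp, hmod⟩ := Nat.forall_exists_prime_gt_and_zmodEq c.toNat hN hc
  obtain ⟨k, hk⟩ := hmod.symm.dvd
  have hN' : (0 : ℤ) < N := by positivity
  have hk0 : 0 < k := by
    by_contra! hk0
    have : (N : ℤ) * k ≤ 0 := mul_nonpos_of_nonneg_of_nonpos hN'.le hk0
    omega
  lift k to ℕ using hk0.le
  exact ⟨p, k, hp, by linarith⟩

lemma isCoprime_two_of_emod {c : ℤ} (h : c % 2 = 1) : IsCoprime c 2 :=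
  ⟨1, -(c / 2), by omega⟩

lemma isCoprime_five_of_emod {c : ℤ} (h : c % 5 ≠ 0) : IsCoprime c 5 := by
  have : c % 5 = 1 ∨ c % 5 = 2 ∨ c % 5 = 3 ∨ c % 5 = 4 := by omega
  rcases this with h | h | h | h
  · exact ⟨1, -(c / 5), by omega⟩
  · exact ⟨3, -(3 * (c / 5) + 1), by omega⟩
  · exact ⟨2, -(2 * (c / 5) + 1), by omega⟩
  · exact ⟨-1, c / 5 + 1, by omega⟩

lemma isCoprime_eight_mul {c : ℤ} {m : ℕ} (h : c % 2 = 1) (hm : IsCoprime c m) :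
    IsCoprime c (8 * m : ℕ) := by
  push_cast
  exact IsCoprime.mul_right (by simpa using (isCoprime_two_of_emod h).pow_right (n := 3)) hm

lemma isCoprime_forty_mul {c : ℤ} {m : ℕ} (h : c % 2 = 1) (h5 : c % 5 ≠ 0)
    (hm : IsCoprime c m) : IsCoprime c (40 * m : ℕ) := by
  rw [show 40 * m = 8 * (5 * m) by ring]
  refine isCoprime_eight_mul h ?_
  push_cast
  exact (isCoprime_five_of_emod h5).mul_right hm

lemma isCoprime_of_mul_eq {e c α m β : ℤ} (h : e * c = α * m - β) (hm : IsCoprime m β) :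
    IsCoprime c m := by
  have h1 : IsCoprime (e * c) m := by
    rw [h, sub_eq_add_neg, add_comm]
    exact IsCoprime.add_mul_right_left hm.symm.neg_left α
  exact h1.of_mul_left_right

lemma represented_of_odd_of_emod_five {n : ℕ} (h2 : n % 2 = 1) (h5 : n % 5 ≠ 0) :
    ∃ x y z : ℤ, x ^ 2 + 2 * y ^ 2 + 5 * z ^ 2 = n := by
  have hc : IsCoprime (7 * n - 10 : ℤ) n := by
    refine isCoprime_of_mul_eq (e := 1) (α := 7) (β := 2 * 5) (by ring) ?_
    exact (isCoprime_two_of_emod (by omega)).mul_right (isCoprime_five_of_emod (by omega))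
  obtain ⟨p, k, hp, hpk⟩ := exists_prime_eq_add_mul (N := 40 * n) (by omega)
    (isCoprime_forty_mul (by omega) (by omega) hc)
  push_cast at hpk
  refine represented_of_prime (τ := 1) (d := 7 + 40 * k) hp ?_ (by omega) (by omega) ?_
  · rw [Nat.odd_iff]
    rw [mul_assoc] at hpk
    generalize (n : ℤ) * k = q at hpk
    omega
  · push_cast
    linarith

lemma represented_of_emod_eight_two_of_emod_five {n : ℕ} (h2 : n % 8 = 2) (h5 : n % 5 ≠ 0) :
    ∃ x y z : ℤ, x ^ 2 + 2 * y ^ 2 + 5 * z ^ 2 = n := by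
  obtain ⟨j, rfl⟩ : ∃ j, n = 2 * (4 * j + 1) := ⟨n / 8, by omega⟩
  have hc : IsCoprime (14 * j + 1 : ℤ) (4 * j + 1 : ℕ) :=
    isCoprime_of_mul_eq (e := 2) (α := 7) (β := 5) (by push_cast; ring)
      (isCoprime_five_of_emod (by omega))
  obtain ⟨p, k, hp, hpk⟩ := exists_prime_eq_add_mul (N := 40 * (4 * j + 1)) (by omega)
    (isCoprime_forty_mul (by omega) (by omega) hc)
  push_cast at hpk
  refine represented_of_prime (τ := 2) (d := 7 + 80 * k) hp ?_ (by omega) (by omega) ?_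
  · rw [Nat.odd_iff]
    rw [mul_assoc] at hpk
    generalize (4 * (j : ℤ) + 1) * k = q at hpk
    omega
  · push_cast
    linarith

lemma represented_of_emod_eight_six_of_emod_five {n : ℕ} (h2 : n % 8 = 6) (h5 : n % 5 ≠ 0) :
    ∃ x y z : ℤ, x ^ 2 + 2 * y ^ 2 + 5 * z ^ 2 = n := by
  have hc : IsCoprime (n - 5 : ℤ) n :=
    isCoprime_of_mul_eq (e := 1) (α := 1) (β := 5) (by ring) (isCoprime_five_of_emod (by omega))
  obtain ⟨p, k, hp, hpk⟩ := exists_prime_eq_add_mul (N := 40 * n) (by omega)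
    (isCoprime_forty_mul (by omega) (by omega) hc)
  push_cast at hpk
  refine represented_of_two_mul_prime (τ := 1) (d := 1 + 40 * k) hp ?_ (by omega) (by omega) ?_
  · rw [mul_assoc] at hpk
    generalize (n : ℤ) * k = q at hpk
    omega
  · push_cast
    linarith

lemma represented_five_mul_of_odd {m : ℕ} (h2 : m % 2 = 1) (h5 : m % 5 = 1 ∨ m % 5 = 4) :
    ∃ x y z : ℤ, x ^ 2 + 2 * y ^ 2 + 5 * z ^ 2 = (5 * m : ℕ) := by
  obtain ⟨e, c, he, he8, he5⟩ : ∃ e c : ℕ, m * e = 5 * c + 2 ∧ e % 8 = 7 ∧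
      (e % 5 = 2 ∨ e % 5 = 3) := by
    rcases h5 with h5 | h5
    · exact ⟨7, (7 * m - 2) / 5, by omega, by norm_num⟩
    · exact ⟨23, (23 * m - 2) / 5, by omega, by norm_num⟩
  have hc2 : c % 2 = 1 := by
    have : m * e % 2 = 1 := by rw [Nat.mul_mod, h2, show e % 2 = 1 by omega]
    omega
  have hc : IsCoprime (c : ℤ) m :=
    isCoprime_of_mul_eq (e := 5) (α := e) (β := 2) (by zify at he; linarith)
      (isCoprime_two_of_emod (by omega))
  obtain ⟨p, k, hp, hpk⟩ := exists_prime_eq_add_mul (N := 8 * m) (by omega)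
    (isCoprime_eight_mul (by omega) hc)
  push_cast at hpk
  refine represented_of_prime (τ := 5) (d := e + 40 * k) hp ?_ (by omega) (by omega) ?_
  · rw [Nat.odd_iff]
    rw [mul_assoc] at hpk
    generalize (m : ℤ) * k = q at hpk
    omega
  · zify at he
    push_cast
    linarith

lemma represented_ten_mul_of_emod_four_one {m : ℕ} (h4 : m % 4 = 1)
    (h5 : m % 5 = 2 ∨ m % 5 = 3) :
    ∃ x y z : ℤ, x ^ 2 + 2 * y ^ 2 + 5 * z ^ 2 = (10 * m : ℕ) := by
  obtain ⟨e, c, he, he8, he5, hc2⟩ : ∃ e c : ℕ, m * e = 10 * c + 1 ∧ e % 8 = 7 ∧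
      (e % 5 = 2 ∨ e % 5 = 3) ∧ c % 2 = 1 := by
    rcases h5 with h5 | h5
    · exact ⟨23, (23 * m - 1) / 10, by omega, by norm_num, by norm_num, by omega⟩
    · exact ⟨7, (7 * m - 1) / 10, by omega, by norm_num, by norm_num, by omega⟩
  have hc : IsCoprime (c : ℤ) m :=
    isCoprime_of_mul_eq (e := 10) (α := e) (β := 1) (by zify at he; linarith) isCoprime_one_right
  obtain ⟨p, k, hp, hpk⟩ := exists_prime_eq_add_mul (N := 8 * m) (by omega)
    (isCoprime_eight_mul (by omega) hc)
  push_cast at hpk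
  refine represented_of_prime (τ := 10) (d := e + 80 * k) hp ?_ (by omega) (by omega) ?_
  · rw [Nat.odd_iff]
    rw [mul_assoc] at hpk
    generalize (m : ℤ) * k = q at hpk
    omega
  · zify at he
    push_cast
    linarith

lemma represented_ten_mul_of_emod_four_three {m : ℕ} (h4 : m % 4 = 3)
    (h5 : m % 5 = 2 ∨ m % 5 = 3) :
    ∃ x y z : ℤ, x ^ 2 + 2 * y ^ 2 + 5 * z ^ 2 = (10 * m : ℕ) := by
  obtain ⟨e, c, he, he4, he5, hc8⟩ : ∃ e c : ℕ, 2 * m * e = 5 * c + 1 ∧ e % 4 = 1 ∧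
      (e % 5 = 1 ∨ e % 5 = 4) ∧ c % 8 = 1 := by
    rcases h5 with h5 | h5
    · exact ⟨9, (18 * m - 1) / 5, by omega, by norm_num, by norm_num, by omega⟩
    · exact ⟨1, (2 * m - 1) / 5, by omega, by norm_num, by norm_num, by omega⟩
  have hc : IsCoprime (c : ℤ) m :=
    isCoprime_of_mul_eq (e := 5) (α := 2 * e) (β := 1) (by zify at he; linarith)
      isCoprime_one_right
  obtain ⟨p, k, hp, hpk⟩ := exists_prime_eq_add_mul (N := 8 * m) (by omega)
    (isCoprime_eight_mul (by omega) hc)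
  push_cast at hpk
  refine represented_of_two_mul_prime (τ := 5) (d := e + 20 * k) hp ?_ (by omega) (by omega) ?_
  · rw [mul_assoc] at hpk
    generalize (m : ℤ) * k = q at hpk
    omega
  · zify at he
    push_cast
    linarith

theorem represented_of_not_exceptional (n : ℕ) (hn : 0 < n)
    (h : ¬ ∃ d u : ℕ, Odd d ∧ (u % 5 = 2 ∨ u % 5 = 3) ∧ n = 5 ^ d * u) :
    ∃ x y z : ℤ, x ^ 2 + 2 * y ^ 2 + 5 * z ^ 2 = n := by
  induction n using Nat.strong_induction_on with
  | _ n ih =>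
    by_cases h4 : n % 4 = 0
    · obtain ⟨m, rfl⟩ := Nat.dvd_of_mod_eq_zero h4
      obtain ⟨x, y, z, e⟩ := ih m (by omega) (by omega) fun ⟨d, u, hd, hu, hm⟩ =>
        h ⟨d, 4 * u, hd, by omega, by rw [hm]; ring⟩
      exact ⟨2 * x, 2 * y, 2 * z, by push_cast; rw [← e]; ring⟩
    by_cases h25 : n % 25 = 0
    · obtain ⟨m, rfl⟩ := Nat.dvd_of_mod_eq_zero h25
      obtain ⟨x, y, z, e⟩ := ih m (by omega) (by omega) fun ⟨d, u, hd, hu, hm⟩ =>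
        h ⟨d + 2, u, hd.add_even even_two, hu, by rw [hm]; ring⟩
      exact ⟨5 * x, 5 * y, 5 * z, by push_cast; rw [← e]; ring⟩
    have h2 : n % 2 = 1 ∨ n % 8 = 2 ∨ n % 8 = 6 := by omega
    by_cases h5 : n % 5 = 0
    · obtain ⟨m, rfl⟩ := Nat.dvd_of_mod_eq_zero h5
      have hm5 : m % 5 = 1 ∨ m % 5 = 4 := by
        have : ¬ (m % 5 = 2 ∨ m % 5 = 3) := fun hm => h ⟨1, m, odd_one, hm, by ring⟩
        omega
      rcases Nat.mod_two_eq_zero_or_one m with hm | hm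
      · obtain ⟨m, rfl⟩ := Nat.dvd_of_mod_eq_zero hm
        rw [← mul_assoc]
        rcases (by omega : m % 4 = 1 ∨ m % 4 = 3) with h1 | h3
        · exact represented_ten_mul_of_emod_four_one h1 (by omega)
        · exact represented_ten_mul_of_emod_four_three h3 (by omega)
      · exact represented_five_mul_of_odd hm hm5
    · rcases h2 with h2 | h2 | h2
      · exact represented_of_odd_of_emod_five h2 h5
      · exact represented_of_emod_eight_two_of_emod_five h2 h5
      · exact represented_of_emod_eight_six_of_emod_five h2 h5

lemma five_dvd_of_dvd_sq_add_two_mul_sq {x y : ℤ} (h : (5 : ℤ) ∣ x ^ 2 + 2 * y ^ 2) :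
    (5 : ℤ) ∣ x ∧ (5 : ℤ) ∣ y := by
  have hy : (5 : ℤ) ∣ y := five_dvd_of_dvd_sq_add (Or.inl (by norm_num)) h
  refine ⟨?_, hy⟩
  apply Int.Prime.dvd_pow' (by norm_num : Nat.Prime 5) (n := x) (k := 2)
  exact (Int.dvd_add_left ((dvd_pow hy two_ne_zero).mul_left 2)).1 h

theorem not_represented_of_exceptional {d u : ℕ} (hd : Odd d) (hu : u % 5 = 2 ∨ u % 5 = 3)
    (x y z : ℤ) : x ^ 2 + 2 * y ^ 2 + 5 * z ^ 2 ≠ 5 ^ d * u := by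
  obtain ⟨k, rfl⟩ := hd
  induction k generalizing x y z with
  | zero =>
    intro h
    obtain ⟨⟨x, rfl⟩, ⟨y, rfl⟩⟩ := five_dvd_of_dvd_sq_add_two_mul_sq (x := x) (y := y)
      ⟨u - z ^ 2, by linear_combination h⟩
    have h1 : z * z = u - 5 * (x ^ 2 + 2 * y ^ 2) := by
      rw [mul_zero, zero_add, pow_one] at h
      linarith
    have hz : z % 5 = 0 ∨ z % 5 = 1 ∨ z % 5 = 2 ∨ z % 5 = 3 ∨ z % 5 = 4 := by omega
    have h2 : z * z % 5 = 2 ∨ z * z % 5 = 3 := by omega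
    rcases hz with hz | hz | hz | hz | hz <;> simp [Int.mul_emod, hz] at h2
  | succ k ih =>
    intro h
    obtain ⟨⟨x, rfl⟩, ⟨y, rfl⟩⟩ := five_dvd_of_dvd_sq_add_two_mul_sq (x := x) (y := y)
      ⟨5 ^ (2 * k + 2) * u - z ^ 2, by linear_combination h⟩
    obtain ⟨z, rfl⟩ : (5 : ℤ) ∣ z := by
      apply Int.Prime.dvd_pow' (by norm_num : Nat.Prime 5) (n := z) (k := 2)
      refine ⟨5 ^ (2 * k + 1) * u - (x ^ 2 + 2 * y ^ 2), ?_⟩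
      rw [show 2 * (k + 1) + 1 = 2 * k + 1 + 2 by ring, pow_add] at h
      push_cast
      linarith
    apply ih x y z
    rw [show 2 * (k + 1) + 1 = 2 * k + 1 + 2 by ring, pow_add] at h
    linarith

theorem stmt_9 (n : ℕ) (hn : 0 < n) :
    (¬ ∃ x y z : ℤ, x ^ 2 + 2 * y ^ 2 + 5 * z ^ 2 = (n : ℤ)) ↔
      ∃ d u : ℕ, Odd d ∧ (u % 5 = 2 ∨ u % 5 = 3) ∧ n = 5 ^ d * u := by
  constructor
  · intro h
    by_contra h'
    exact h (represented_of_not_exceptional n hn h')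
  · rintro ⟨d, u, hd, hu, rfl⟩ ⟨x, y, z, h⟩
    exact not_represented_of_exceptional hd hu x y z (by exact_mod_cast h)
end

section
/- If n is a positive integer of the form 2^e·u (e even, u ≡ 7 mod 8) with n ≥ 30, and m = 15, then at least one of n − 15 and n − 30 is NOT of the form 2^e·u with e even and u ≡ 7 (mod 8); consequently at least one of n − 15, n − 30 is a sum of three integer squares. -/
/-- In a reduced positive definite binary form with matrix `!![A, B; B, C]`, the square of the
leading coefficient is at most `4 / 3` times the determinant. -/
theorem three_mul_sq_le_of_reduced {A B C δ : ℤ} (hA : 0 < A) (h₁ : 2 * B ≤ A) (h₂ : -A ≤ 2 * B)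
    (hAC : A ≤ C) (hδ : A * C = δ + B ^ 2) : 3 * A ^ 2 ≤ 4 * δ := by
  have hB : (2 * B) ^ 2 ≤ A ^ 2 := sq_le_sq' h₂ h₁
  have := mul_le_mul_of_nonneg_left hAC hA.le
  linarith

theorem eq_one_of_three_mul_sq_le {a D : ℤ} (ha : 0 < a) (h₁ : 3 * a ^ 2 ≤ 4 * D)
    (h₂ : 3 * D ^ 2 ≤ 4 * a) : a = 1 := by
  have h₃ : (3 * a ^ 2) ^ 2 ≤ (4 * D) ^ 2 := by gcongr
  have h₄ : a * (27 * a ^ 3) ≤ a * 64 := by linarith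
  have h₅ := le_of_mul_le_mul_left h₄ ha
  by_contra hne
  have h₆ : (2 : ℤ) ^ 3 ≤ a ^ 3 := by gcongr; omega
  linarith

theorem exists_two_mul_add_mul_le {m : ℤ} (hm : 0 < m) (r : ℤ) :
    ∃ t : ℤ, 2 * (r + t * m) ≤ m ∧ -m ≤ 2 * (r + t * m) := by
  have h₁ := Int.emod_add_mul_ediv (2 * r + m) (2 * m)
  have h₂ := Int.emod_nonneg (2 * r + m) (show 2 * m ≠ 0 by omega)
  have h₃ := Int.emod_lt_of_pos (2 * r + m) (show 0 < 2 * m by omega)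
  refine ⟨-((2 * r + m) / (2 * m)), ?_, ?_⟩ <;> nlinarith

/-- A positive definite integral ternary quadratic form of determinant one takes only sums of
three squares as values. The naturals `N` and `M` are the first two leading principal minors. -/
theorem exists_sum_three_sq_of_ternary_form (N M : ℕ) (a b c d e f : ℤ)
    (haN : a.toNat = N) (hDM : (a * b - d ^ 2).toNat = M) (ha : 0 < a) (hD : 0 < a * b - d ^ 2)
    (hdet : a * b * c + 2 * d * e * f - a * f ^ 2 - b * e ^ 2 - c * d ^ 2 = 1) (x y z : ℤ) :
    ∃ u v w : ℤ, u ^ 2 + v ^ 2 + w ^ 2 =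
      a * x ^ 2 + b * y ^ 2 + c * z ^ 2 + 2 * d * x * y + 2 * e * x * z + 2 * f * y * z := by
  induction N using Nat.strong_induction_on generalizing M a b c d e f x y z with
  | _ N ihN =>
  induction M using Nat.strong_induction_on generalizing a b c d e f x y z with
  | _ M ihM =>
  -- translate the third basis vector along the second
  obtain ⟨t, ht₁, ht₂⟩ : ∃ t : ℤ, 2 * ((a * f - d * e) + t * (a * b - d ^ 2)) ≤ a * b - d ^ 2 ∧
      -(a * b - d ^ 2) ≤ 2 * ((a * f - d * e) + t * (a * b - d ^ 2)) :=
    exists_two_mul_add_mul_le hD _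
  obtain ⟨c', hc'⟩ : ∃ c', c' = c + 2 * t * f + t ^ 2 * b := ⟨_, rfl⟩
  obtain ⟨e', he'⟩ : ∃ e', e' = e + t * d := ⟨_, rfl⟩
  obtain ⟨f', hf'⟩ : ∃ f', f' = f + t * b := ⟨_, rfl⟩
  have hdet' : a * b * c' + 2 * d * e' * f' - a * f' ^ 2 - b * e' ^ 2 - c' * d ^ 2 = 1 := by
    subst hc' he' hf'; linear_combination hdet
  have hE₁ : 2 * (a * f' - d * e') ≤ a * b - d ^ 2 := by subst he' hf'; linarith
  have hE₂ : -(a * b - d ^ 2) ≤ 2 * (a * f' - d * e') := by subst he' hf'; linarith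
  have hDF : (a * b - d ^ 2) * (a * c' - e' ^ 2) = a + (a * f' - d * e') ^ 2 := by
    linear_combination a * hdet'
  have hF : 0 < a * c' - e' ^ 2 := by
    refine pos_of_mul_pos_right (a := a * b - d ^ 2) ?_ hD.le
    rw [hDF]; positivity
  by_cases hFD : a * c' - e' ^ 2 < a * b - d ^ 2
  · obtain ⟨u, v, w, h⟩ := ihM (a * c' - e' ^ 2).toNat (by omega) a c' b e' d f' haN rfl ha hF
      (by linear_combination hdet') x z (y - t * z)
    exact ⟨u, v, w, by rw [h]; subst hc' he' hf'; ring⟩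
  -- translate the second basis vector along the first
  obtain ⟨s, hs₁, hs₂⟩ : ∃ s : ℤ, 2 * (d + s * a) ≤ a ∧ -a ≤ 2 * (d + s * a) :=
    exists_two_mul_add_mul_le ha d
  obtain ⟨b', hb'⟩ : ∃ b', b' = b + 2 * s * d + s ^ 2 * a := ⟨_, rfl⟩
  obtain ⟨d', hd'⟩ : ∃ d', d' = d + s * a := ⟨_, rfl⟩
  obtain ⟨f'', hf''⟩ : ∃ f'', f'' = f' + s * e' := ⟨_, rfl⟩
  have hdet'' : a * b' * c' + 2 * d' * e' * f'' - a * f'' ^ 2 - b' * e' ^ 2 - c' * d' ^ 2 = 1 := by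
    subst hb' hd' hf''; linear_combination hdet'
  have hDD : a * b' - d' ^ 2 = a * b - d ^ 2 := by subst hb' hd'; ring
  have hEE : a * f'' - d' * e' = a * f' - d * e' := by subst hd' hf''; ring
  rw [← hDD] at hD hE₁ hE₂ hDF hFD
  rw [← hEE] at hE₁ hE₂ hDF
  rw [← hd'] at hs₁ hs₂
  have hvalue : a * x ^ 2 + b * y ^ 2 + c * z ^ 2 + 2 * d * x * y + 2 * e * x * z + 2 * f * y * z =
      a * (x - s * (y - t * z)) ^ 2 + b' * (y - t * z) ^ 2 + c' * z ^ 2 +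
        2 * d' * (x - s * (y - t * z)) * (y - t * z) + 2 * e' * (x - s * (y - t * z)) * z +
        2 * f'' * (y - t * z) * z := by
    subst hb' hd' hf'' hc' he' hf'; ring
  rw [hvalue]
  generalize x - s * (y - t * z) = X
  generalize y - t * z = Y
  have hb : 0 < b' := by
    refine pos_of_mul_pos_right (a := a) ?_ ha.le
    linarith [sq_nonneg d']
  by_cases hba : b' < a
  · obtain ⟨u, v, w, h⟩ := ihN b'.toNat (by omega) _ b' a c' d' f'' e' rfl rfl hb
      (by linarith) (by linear_combination hdet'') Y X z
    exact ⟨u, v, w, by rw [h]; ring⟩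
  -- the form is now reduced
  push Not at hFD hba
  have hD₂ := three_mul_sq_le_of_reduced hD hE₁ hE₂ hFD hDF
  have ha₂ := three_mul_sq_le_of_reduced ha hs₁ hs₂ hba
    (show a * b' = (a * b' - d' ^ 2) + d' ^ 2 by ring)
  have ha₁ : a = 1 := eq_one_of_three_mul_sq_le ha ha₂ hD₂
  subst ha₁
  obtain rfl : d' = 0 := by omega
  obtain rfl : b' = 1 := by
    have := eq_one_of_three_mul_sq_le hD hD₂ ha₂
    linarith
  obtain rfl : f'' = 0 := by omega
  exact ⟨X + e' * z, Y, z, by linear_combination (-z ^ 2) * hdet''⟩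

theorem exists_sum_three_sq_of_dvd_s11 (n k q x : ℤ) (hk : 0 < k) (hq : 0 < q) (hqk : q = k * n - 1)
    (hx : q ∣ x ^ 2 + k) : ∃ u v w : ℤ, u ^ 2 + v ^ 2 + w ^ 2 = n := by
  obtain ⟨a, ha⟩ := hx
  have ha₀ : 0 < a := by
    refine pos_of_mul_pos_right (a := q) ?_ hq.le
    rw [← ha]; positivity
  have hD : a * q - x ^ 2 = k := by linear_combination -ha
  obtain ⟨u, v, w, h⟩ := exists_sum_three_sq_of_ternary_form _ _ a q n x 1 0 rfl rfl ha₀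
    (by rw [hD]; exact hk) (by linear_combination n * hD - hqk) 0 0 1
  exact ⟨u, v, w, by rw [h]; ring⟩

theorem jacobiSym_neg_eq_one_of_two_mul_eq {n k p : ℕ} (hn : n % 4 = 1) (hk : k % 8 = 3)
    (hp : 2 * p + 1 = k * n) : jacobiSym (-k) p = 1 := by
  have hkn : (k * n) % 8 = (3 * (n % 8)) % 8 := by rw [Nat.mul_mod, hk]
  have hkodd : Odd k := Nat.odd_iff.2 (by omega)
  have hpodd : Odd p := Nat.odd_iff.2 (by omega)
  have hpk : jacobiSym p k = 1 := by
    have h₂ : jacobiSym 2 k = -1 := by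
      rw [jacobiSym.at_two hkodd, ZMod.χ₈_nat_eq_if_mod_eight]
      simp [hk, show k % 2 = 1 by omega]
    have h₃ : jacobiSym (2 * p) k = -1 := by
      have : jacobiSym (2 * p) k = jacobiSym (-1) k := by
        apply jacobiSym.mod_left'
        apply Int.emod_emod_of_dvd _ (dvd_refl _) |>.symm.trans
        rw [show (2 * p : ℤ) = -1 + k * n by
          have : (2 * p + 1 : ℤ) = k * n := by exact_mod_cast hp
          linarith]
        simp
      rw [this, jacobiSym.at_neg_one hkodd, ZMod.χ₄_nat_three_mod_four (by omega)]
    rw [jacobiSym.mul_left, h₂] at h₃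
    linarith
  rw [jacobiSym.neg _ hpodd]
  rcases (by omega : p % 4 = 1 ∨ p % 4 = 3) with h | h
  · rw [ZMod.χ₄_nat_one_mod_four h, ← jacobiSym.quadratic_reciprocity_one_mod_four h hkodd, hpk,
      one_mul]
  · rw [ZMod.χ₄_nat_three_mod_four h,
      jacobiSym.quadratic_reciprocity_three_mod_four (by omega) h, hpk]
    norm_num

theorem exists_sum_three_sq_of_mod_four_eq_one {n : ℕ} (hn : n % 4 = 1) :
    ∃ u v w : ℤ, u ^ 2 + v ^ 2 + w ^ 2 = (n : ℤ) := by
  obtain ⟨r, hr⟩ : ∃ r, 2 * r + 1 = 3 * n := ⟨(3 * n - 1) / 2, by omega⟩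
  have hcop : Nat.Coprime r (4 * n) := by
    have hn' : Nat.Coprime r n := by
      refine Nat.Coprime.of_dvd_right (dvd_mul_left n 3) ?_
      rw [← hr]; simp
    have h₂ : Nat.Coprime r 2 := (Nat.coprime_two_right).2 (Nat.odd_iff.2 (by omega))
    exact Nat.Coprime.mul_right (h₂.pow_right 2) hn'
  obtain ⟨p, hpr, hp, hmod⟩ :=
    Nat.forall_exists_prime_gt_and_modEq r (q := 4 * n) (by omega) hcop
  obtain ⟨j, hj⟩ := (Nat.modEq_iff_dvd' hpr.le).1 hmod.symm
  have hp' : 2 * p + 1 = (8 * j + 3) * n := by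
    rw [show p = r + 4 * n * j by omega]; linear_combination hr
  obtain ⟨k, hk⟩ : ∃ k, k = 8 * j + 3 := ⟨_, rfl⟩
  rw [← hk] at hp'
  have hJ := jacobiSym_neg_eq_one_of_two_mul_eq hn (by omega) hp'
  have := Fact.mk hp
  obtain ⟨y, hy⟩ := ZMod.isSquare_of_jacobiSym_eq_one hJ
  obtain ⟨x, rfl⟩ := ZMod.intCast_surjective y
  have hdvd : (p : ℤ) ∣ x ^ 2 + k := by
    rw [← ZMod.intCast_zmod_eq_zero_iff_dvd]
    push_cast at hy ⊢
    linear_combination -hy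
  have hpodd : p % 2 = 1 := by
    have : (k * n) % 8 = (3 * (n % 8)) % 8 := by rw [Nat.mul_mod, show k % 8 = 3 by omega]
    omega
  obtain ⟨x', hx'odd, hx'⟩ : ∃ x' : ℤ, x' % 2 = 1 ∧ (p : ℤ) ∣ x' ^ 2 + k := by
    rcases Int.emod_two_eq_zero_or_one x with h | h
    · refine ⟨x + p, by omega, ?_⟩
      rw [show (x + p) ^ 2 + k = (x ^ 2 + k) + p * (2 * x + p : ℤ) by ring]
      exact dvd_add hdvd (dvd_mul_right _ _)
    · exact ⟨x, h, hdvd⟩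
  have h2 : (2 : ℤ) ∣ x' ^ 2 + k := by
    have : Odd (x' ^ 2) := (Int.odd_iff.2 hx'odd).pow
    rw [Int.odd_iff] at this
    omega
  have hcop2 : IsCoprime (2 : ℤ) p := by
    have : Nat.Coprime 2 p := (Nat.coprime_two_left).2 (Nat.odd_iff.2 hpodd)
    exact_mod_cast Nat.isCoprime_iff_coprime.2 this
  refine exists_sum_three_sq_of_dvd_s11 n k (2 * p) x' (by omega) (by have := hp.pos; omega) ?_
    (hcop2.mul_dvd h2 hx')
  have : (2 * p + 1 : ℤ) = k * n := by exact_mod_cast hp'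
  linarith

theorem not_exists_eq_two_pow_mul_of_mod_four_eq_one {n : ℕ} (hn : n % 4 = 1) :
    ¬ ∃ e u : ℕ, Even e ∧ u % 8 = 7 ∧ n = 2 ^ e * u := by
  rintro ⟨e, u, -, hu, rfl⟩
  rcases e with _ | e
  · omega
  · rw [pow_succ, mul_right_comm] at hn
    omega

theorem stmt_11 (n : ℕ) (hn : 30 ≤ n)
    (hform : ∃ a b : ℕ, n = 4 ^ a * (8 * b + 7)) :
    ((¬ ∃ e u : ℕ, Even e ∧ u % 8 = 7 ∧ n - 15 = 2 ^ e * u) ∨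
      (¬ ∃ e u : ℕ, Even e ∧ u % 8 = 7 ∧ n - 30 = 2 ^ e * u)) ∧
    ((∃ x y z : ℤ, x ^ 2 + y ^ 2 + z ^ 2 = ((n - 15 : ℕ) : ℤ)) ∨
      (∃ x y z : ℤ, x ^ 2 + y ^ 2 + z ^ 2 = ((n - 30 : ℕ) : ℤ))) := by
  have key : (n - 15) % 4 = 1 ∨ (n - 30) % 4 = 1 := by
    obtain ⟨a, b, rfl⟩ := hform
    rcases a with _ | a
    · omega
    · rw [pow_succ, mul_right_comm] at hn ⊢
      omega
  exact ⟨key.imp not_exists_eq_two_pow_mul_of_mod_four_eq_one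
      not_exists_eq_two_pow_mul_of_mod_four_eq_one,
    key.imp exists_sum_three_sq_of_mod_four_eq_one exists_sum_three_sq_of_mod_four_eq_one⟩
end

section
/- For m = 15: every positive integer of the form 4^a(8b+7) that is at least 30 is represented by the integral quadratic form x₁² + x₁x₂ + 4x₂² + y₁² + y₁y₂ + 4y₂² + z₁² + z₁z₂ + 4z₂² (six integer variables). -/
/-- Every residue class modulo `a` has a representative of absolute value at most `a / 2`. -/
theorem exists_add_mul_abs_le {a : ℤ} (ha : 0 < a) (f : ℤ) :
    ∃ k : ℤ, -a ≤ 2 * (f + k * a) ∧ 2 * (f + k * a) ≤ a := by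
  have h₁ := Int.emod_add_mul_ediv (2 * f + a) (2 * a)
  have h₂ := Int.emod_nonneg (2 * f + a) (show 2 * a ≠ 0 by positivity)
  have h₃ := Int.emod_lt_of_pos (2 * f + a) (show 0 < 2 * a by positivity)
  refine ⟨-((2 * f + a) / (2 * a)), ?_, ?_⟩ <;> nlinarith

/-- Lagrange reduction: a positive definite binary form is properly equivalent to one whose leading
coefficient is at most `√(4 / 3)` times the square root of the determinant. -/
theorem exists_binary_reduction (n : ℕ) (B C D : ℤ) (hn : B.toNat = n) (hB : 0 < B)
    (hdet : 0 < B * D - C ^ 2) :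
    ∃ p q r s : ℤ, p * s - q * r = 1 ∧
      3 * (B * p ^ 2 + 2 * C * p * r + D * r ^ 2) ^ 2 ≤ 4 * (B * D - C ^ 2) := by
  induction n using Nat.strong_induction_on generalizing B C D with
  | _ n ih =>
    by_cases h : 3 * B ^ 2 ≤ 4 * (B * D - C ^ 2)
    · exact ⟨1, 0, 0, 1, by norm_num, by simpa using h⟩
    · obtain ⟨k, hk₁, hk₂⟩ := exists_add_mul_abs_le hB C
      set C' := C + k * B with hC'
      set D' := D + 2 * k * C + k ^ 2 * B with hD'
      have hdet' : B * D' - C' ^ 2 = B * D - C ^ 2 := by rw [hC', hD']; ring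
      have hD'pos : 0 < D' := by
        by_contra hneg
        nlinarith [sq_nonneg C', mul_nonneg hB.le (show 0 ≤ -D' by linarith)]
      have hlt : D' < B := by
        have hC'sq : 4 * C' ^ 2 ≤ B ^ 2 := by nlinarith
        by_contra hge
        nlinarith [mul_le_mul_of_nonneg_left (not_lt.mp hge) hB.le]
      obtain ⟨p, q, r, s, hpq, hle⟩ := ih D'.toNat (by omega) D' (-C') B rfl hD'pos
        (by linarith [show D' * B - (-C') ^ 2 = B * D' - C' ^ 2 by ring])
      refine ⟨k * p - r, k * q - s, p, q, by linear_combination hpq, ?_⟩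
      have h₁ : B * (k * p - r) ^ 2 + 2 * C * (k * p - r) * p + D * p ^ 2 =
          D' * p ^ 2 + 2 * (-C') * p * r + B * r ^ 2 := by rw [hC', hD']; ring
      rw [h₁]
      linarith [show D' * B - (-C') ^ 2 = B * D' - C' ^ 2 by ring]

/-- In a ternary form of determinant one, reduced in its first two variables, the second diagonal
coefficient `b` is smaller than the first one, unless the latter is `1`. -/
theorem lt_of_reduced {a b f : ℤ} (ha : 2 ≤ a) (hle : 3 * (a * b - f ^ 2) ^ 2 ≤ 4 * a)
    (hf₁ : -a ≤ 2 * f) (hf₂ : 2 * f ≤ a) : b < a := by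
  have hf : 4 * f ^ 2 ≤ a ^ 2 := by nlinarith
  by_contra hba
  have h₁ : 3 * a ^ 2 ≤ 4 * (a * b - f ^ 2) := by
    nlinarith [mul_le_mul_of_nonneg_left (not_lt.mp hba) (show 0 ≤ a by linarith)]
  have h₂ : (3 * a ^ 2) ^ 2 ≤ (4 * (a * b - f ^ 2)) ^ 2 :=
    pow_le_pow_left₀ (by positivity) h₁ 2
  have h₃ : a * 2 ^ 3 ≤ a * a ^ 3 :=
    mul_le_mul_of_nonneg_left (pow_le_pow_left₀ (by norm_num) ha 3) (by linarith)
  linarith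

/-- Every value of a positive definite ternary form of determinant one is a sum of three squares. -/
theorem ternary_det_one_eq_sum_three_sq (n : ℕ) (a b c d e f : ℤ) (hn : a.toNat = n) (ha : 0 < a)
    (hab : 0 < a * b - f ^ 2)
    (hdet : a * b * c + 2 * d * e * f - a * d ^ 2 - b * e ^ 2 - c * f ^ 2 = 1) (x y z : ℤ) :
    ∃ u v w : ℤ, a * x ^ 2 + b * y ^ 2 + c * z ^ 2 + 2 * d * y * z + 2 * e * x * z +
      2 * f * x * y = u ^ 2 + v ^ 2 + w ^ 2 := by
  induction n using Nat.strong_induction_on generalizing a b c d e f x y z with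
  | _ n ih =>
    have hG : (a * b - f ^ 2) * (a * c - e ^ 2) - (a * d - e * f) ^ 2 = a := by
      linear_combination a * hdet
    obtain ⟨p, q, r, s, hpq, hle⟩ := exists_binary_reduction _ (a * b - f ^ 2) (a * d - e * f)
      (a * c - e ^ 2) rfl hab (by rw [hG]; exact ha)
    rw [hG] at hle
    obtain ⟨b', hb'⟩ : ∃ b', b' = b * p ^ 2 + 2 * d * p * r + c * r ^ 2 := ⟨_, rfl⟩
    obtain ⟨c', hc'⟩ : ∃ c', c' = b * q ^ 2 + 2 * d * q * s + c * s ^ 2 := ⟨_, rfl⟩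
    obtain ⟨d', hd'⟩ : ∃ d', d' = b * p * q + d * (p * s + q * r) + c * r * s := ⟨_, rfl⟩
    obtain ⟨e', he'⟩ : ∃ e', e' = f * q + e * s := ⟨_, rfl⟩
    obtain ⟨f', hf'⟩ : ∃ f', f' = f * p + e * r := ⟨_, rfl⟩
    obtain ⟨y', hy'⟩ : ∃ y', y' = s * y - q * z := ⟨_, rfl⟩
    obtain ⟨z', hz'⟩ : ∃ z', z' = p * z - r * y := ⟨_, rfl⟩
    have hy : y = p * y' + q * z' := by rw [hy', hz']; linear_combination -y * hpq
    have hz : z = r * y' + s * z' := by rw [hy', hz']; linear_combination -z * hpq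
    have hval : a * x ^ 2 + b * y ^ 2 + c * z ^ 2 + 2 * d * y * z + 2 * e * x * z + 2 * f * x * y =
        a * x ^ 2 + b' * y' ^ 2 + c' * z' ^ 2 + 2 * d' * y' * z' + 2 * e' * x * z' +
          2 * f' * x * y' := by
      rw [hy, hz, hb', hc', hd', he', hf']; ring
    have hdet' : a * b' * c' + 2 * d' * e' * f' - a * d' ^ 2 - b' * e' ^ 2 - c' * f' ^ 2 = 1 := by
      rw [hb', hc', hd', he', hf']
      linear_combination (p * s - q * r) ^ 2 * hdet + (p * s - q * r + 1) * hpq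
    have hB : (a * b - f ^ 2) * p ^ 2 + 2 * (a * d - e * f) * p * r + (a * c - e ^ 2) * r ^ 2 =
        a * b' - f' ^ 2 := by rw [hb', hf']; ring
    rw [hB] at hle
    have hG' : (a * b' - f' ^ 2) * (a * c' - e' ^ 2) - (a * d' - e' * f') ^ 2 = a := by
      linear_combination a * hdet'
    have hBpos : 0 < a * b' - f' ^ 2 := by
      have hsq : (a * b - f ^ 2) * (a * b' - f' ^ 2) =
          ((a * b - f ^ 2) * p + (a * d - e * f) * r) ^ 2 + a * r ^ 2 := by
        rw [← hB]; linear_combination r ^ 2 * hG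
      have hnonneg : 0 ≤ a * b' - f' ^ 2 :=
        (mul_nonneg_iff_of_pos_left hab).mp (by rw [hsq]; positivity)
      refine lt_of_le_of_ne hnonneg fun h0 => ?_
      rw [← h0, zero_mul] at hG'
      linarith [sq_nonneg (a * d' - e' * f')]
    clear hG hB hb' hc' hd' he' hf' hy hz hy' hz' hab hdet
    rw [hval]
    obtain rfl | ha₂ : a = 1 ∨ 2 ≤ a := by omega
    · have hB₁ : 1 * b' - f' ^ 2 = 1 := by nlinarith
      refine ⟨x + f' * y' + e' * z', y' + (d' - e' * f') * z', z', ?_⟩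
      obtain rfl : b' = 1 + f' ^ 2 := by linarith
      linear_combination z' ^ 2 * hdet'
    · obtain ⟨k, hk₁, hk₂⟩ := exists_add_mul_abs_le ha f'
      set f₂ := f' + k * a with hf₂
      set b₂ := b' + 2 * k * f' + k ^ 2 * a with hb₂
      have hB₂ : a * b₂ - f₂ ^ 2 = a * b' - f' ^ 2 := by rw [hf₂, hb₂]; ring
      have hb₂pos : 0 < b₂ := by
        by_contra hneg
        nlinarith [sq_nonneg f₂, mul_nonneg ha.le (show 0 ≤ -b₂ by linarith)]
      have hlt : b₂ < a := lt_of_reduced ha₂ (by rwa [hB₂]) hk₁ hk₂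
      obtain ⟨u, v, w, h⟩ := ih b₂.toNat (by omega) b₂ a c' e' (d' + k * e') f₂ rfl hb₂pos
        (by linarith [mul_comm a b₂]) (by rw [hf₂, hb₂]; linear_combination hdet')
        y' (x - k * y') z'
      refine ⟨u, v, w, ?_⟩
      rw [← h, hf₂, hb₂]
      ring

open NumberTheorySymbols in
/-- Every positive integer congruent to `2` modulo `4` is a sum of three squares. -/
theorem sum_three_sq_of_mod_four_eq_two {N : ℕ} (hN : N % 4 = 2) :
    ∃ u v w : ℤ, (N : ℤ) = u ^ 2 + v ^ 2 + w ^ 2 := by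
  have hcop : IsCoprime ((N : ℤ) - 1) ((4 * N : ℕ) : ℤ) := by
    push_cast
    refine IsCoprime.mul_right ⟨1, -((N / 4 : ℕ) : ℤ), ?_⟩ ⟨-1, 1, by ring⟩
    omega
  obtain ⟨p, hpN, hp, hmod⟩ :=
    Nat.forall_exists_prime_gt_and_zmodEq N (q := 4 * N) (by omega) hcop
  obtain ⟨k, hk⟩ := hmod.symm.dvd
  push_cast at hk
  have hk0 : 0 ≤ k := by
    by_contra hneg
    nlinarith
  lift k to ℕ using hk0
  obtain ⟨b, hb⟩ : ∃ b, b = 4 * k + 1 := ⟨_, rfl⟩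
  have hpb : (p : ℤ) = b * N - 1 := by rw [hb]; push_cast; linarith
  have hp4 : p % 4 = 1 := by
    have : (p : ℤ) = 4 * (N * k) + N - 1 := by linarith
    generalize (N : ℤ) * k = t at this
    omega
  have : Fact p.Prime := ⟨hp⟩
  have hpodd : Odd p := Nat.odd_iff.mpr (by omega)
  have hbodd : Odd b := Nat.odd_iff.mpr (by omega)
  have hJ : J(-(b : ℤ) | p) = 1 := by
    rw [jacobiSym.neg _ hpodd, ZMod.χ₄_nat_one_mod_four hp4, one_mul,
      jacobiSym.quadratic_reciprocity_one_mod_four (by omega) hpodd,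
      jacobiSym.mod_left' (a₂ := -1), jacobiSym.at_neg_one hbodd,
      ZMod.χ₄_nat_one_mod_four (by omega)]
    rw [hpb, sub_eq_add_neg, Int.mul_add_emod_self_left]
  obtain ⟨t, ht⟩ := ZMod.isSquare_of_jacobiSym_eq_one hJ
  obtain ⟨t, rfl⟩ := ZMod.intCast_surjective t
  obtain ⟨a, ha⟩ : (p : ℤ) ∣ b + t ^ 2 := by
    rw [← ZMod.intCast_zmod_eq_zero_iff_dvd]
    push_cast at ht ⊢
    linear_combination -ht
  have hbpos : (0 : ℤ) < b := by omega
  have hapos : 0 < a := by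
    have : 0 < (p : ℤ) * a := by rw [← ha]; positivity
    exact pos_of_mul_pos_right this (by positivity)
  obtain ⟨u, v, w, h⟩ := ternary_det_one_eq_sum_three_sq _ a p N 0 1 t rfl hapos
    (by linarith [mul_comm a (p : ℤ)]) (by linear_combination -N * ha - hpb) 0 0 1
  exact ⟨u, v, w, by linarith⟩

theorem stmt_15 (n : ℕ) (hform : ∃ a b : ℕ, n = 4 ^ a * (8 * b + 7)) (hn : 30 ≤ n) :
    ∃ x₁ x₂ y₁ y₂ z₁ z₂ : ℤ,
      x₁ ^ 2 + x₁ * x₂ + 4 * x₂ ^ 2 + y₁ ^ 2 + y₁ * y₂ + 4 * y₂ ^ 2 +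
        z₁ ^ 2 + z₁ * z₂ + 4 * z₂ ^ 2 = (n : ℤ) := by
  have key : ∀ u v w : ℤ, (4 * n - 30 : ℤ) = (2 * u + 1) ^ 2 + (2 * v + 1) ^ 2 + (2 * w) ^ 2 →
      ∃ x₁ x₂ y₁ y₂ z₁ z₂ : ℤ,
      x₁ ^ 2 + x₁ * x₂ + 4 * x₂ ^ 2 + y₁ ^ 2 + y₁ * y₂ + 4 * y₂ ^ 2 +
        z₁ ^ 2 + z₁ * z₂ + 4 * z₂ ^ 2 = (n : ℤ) :=
    fun u v w h => ⟨u, 1, v, 1, w, 0, by linarith⟩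
  obtain ⟨u, v, w, h⟩ := sum_three_sq_of_mod_four_eq_two (N := 4 * n - 30) (by omega)
  rw [Nat.cast_sub (by omega)] at h
  push_cast at h
  obtain ⟨u, rfl | rfl⟩ := Int.even_or_odd' u <;> obtain ⟨v, rfl | rfl⟩ := Int.even_or_odd' v <;>
    obtain ⟨w, rfl | rfl⟩ := Int.even_or_odd' w <;> ring_nf at h
  all_goals first
    | omega
    | exact key u v w (by linarith)
    | exact key u w v (by linarith)
    | exact key v w u (by linarith)
end

section
/- The Hermitian lattice ⟨1,1⟩ over ℚ(√−11) is universal: the quadratic form x₁² + x₁x₂ + 3x₂² + y₁² + y₁y₂ + 3y₂² in four integer variables represents every positive integer. -/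
/-- The integer `n` is a sum of two norms from `ℤ[(1+√-11)/2]`. -/
def IsSumTwoNorms (n : ℤ) : Prop :=
  ∃ x₁ x₂ y₁ y₂ : ℤ,
    x₁ ^ 2 + x₁ * x₂ + 3 * x₂ ^ 2 + y₁ ^ 2 + y₁ * y₂ + 3 * y₂ ^ 2 = n

/-- The form is the reduced norm of the quaternion order `𝓞 ⊕ 𝓞 j` with `j² = -1`. -/
theorem IsSumTwoNorms.mul {m n : ℤ} (hm : IsSumTwoNorms m) (hn : IsSumTwoNorms n) :
    IsSumTwoNorms (m * n) := by
  obtain ⟨a, a', b, b', rfl⟩ := hm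
  obtain ⟨c, c', d, d', rfl⟩ := hn
  refine ⟨(a * c - 3 * a' * c') - (b * (d + d') + 3 * b' * d'),
    (a * c' + a' * c + a' * c') - (b' * d - b * d'),
    (a * d - 3 * a' * d') + (b * (c + c') + 3 * b' * c'),
    (a * d' + a' * d + a' * d') + (b' * c - b * c'), ?_⟩
  ring

theorem exists_abs_sub_two_mul_le {m : ℤ} (hm : 0 < m) (k : ℤ) :
    ∃ q : ℤ, -m ≤ k - 2 * (m * q) ∧ k - 2 * (m * q) ≤ m := by
  refine ⟨(k + m) / (2 * m), ?_⟩
  have h₁ := Int.emod_add_mul_ediv (k + m) (2 * m)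
  have h₂ := Int.emod_nonneg (k + m) (b := 2 * m) (by lia)
  have h₃ := Int.emod_lt_of_pos (k + m) (b := 2 * m) (by lia)
  constructor <;> linarith

theorem exists_norm_sub_mul_lt {m : ℤ} (hm : 3 ≤ m) (b₁ b₂ : ℤ) :
    ∃ q₁ q₂ : ℤ, (b₁ - m * q₁) ^ 2 + (b₁ - m * q₁) * (b₂ - m * q₂) + 3 * (b₂ - m * q₂) ^ 2 + 1
      < m ^ 2 := by
  obtain ⟨q₂, h₁, h₂⟩ := exists_abs_sub_two_mul_le (by lia : 0 < m) (2 * b₂)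
  obtain ⟨q₁, h₃, h₄⟩ := exists_abs_sub_two_mul_le (by lia : 0 < m) (2 * b₁ + (b₂ - m * q₂))
  obtain ⟨r, hr⟩ : ∃ r, r = b₂ - m * q₂ := ⟨_, rfl⟩
  obtain ⟨s, hs⟩ : ∃ s, s = b₁ - m * q₁ := ⟨_, rfl⟩
  have h₁ : -m ≤ 2 * r := by linarith
  have h₂ : 2 * r ≤ m := by linarith
  have h₃ : -m ≤ 2 * s + r := by linarith
  have h₄ : 2 * s + r ≤ m := by linarith
  by_cases hlt : s ^ 2 + s * r + 3 * r ^ 2 + 1 < m ^ 2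
  · exact ⟨q₁, q₂, by rwa [← hr, ← hs]⟩
  have hm4 : m ≤ 4 := by
    by_contra! h
    nlinarith
  have hr₁ : -2 ≤ r := by lia
  have hr₂ : r ≤ 2 := by lia
  have hs₁ : -3 ≤ s := by lia
  have hs₂ : s ≤ 3 := by lia
  have key : ∃ i j : ℤ, (s - m * i) ^ 2 + (s - m * i) * (r - m * j) + 3 * (r - m * j) ^ 2 + 1
      < m ^ 2 := by
    obtain rfl | rfl : m = 3 ∨ m = 4 := by lia
    · exfalso
      interval_cases r <;> interval_cases s <;> lia
    · obtain ⟨rfl, rfl⟩ | ⟨rfl, rfl⟩ | ⟨rfl, rfl⟩ | ⟨rfl, rfl⟩ :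
          (r = 2 ∧ s = 1) ∨ (r = 2 ∧ s = -3) ∨ (r = -2 ∧ s = 3) ∨ (r = -2 ∧ s = -1) := by
        interval_cases r <;> interval_cases s <;> lia
      · exact ⟨0, 1, by norm_num⟩
      · exact ⟨-1, 1, by norm_num⟩
      · exact ⟨1, -1, by norm_num⟩
      · exact ⟨0, -1, by norm_num⟩
  obtain ⟨i, j, hij⟩ := key
  refine ⟨q₁ + i, q₂ + j, ?_⟩
  rw [hr, hs] at hij
  convert hij using 1
  ring

/-- The Hermitian form `a N(u) + Tr(b u v̄) + c N(v)` over `ℤ[(1+√-11)/2]`, where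
`b = b₁ + b₂ (1+√-11)/2` and similarly for `u` and `v`. -/
def hermitianForm (a b₁ b₂ c u₁ u₂ v₁ v₂ : ℤ) : ℤ :=
  a * (u₁ ^ 2 + u₁ * u₂ + 3 * u₂ ^ 2)
    + (2 * b₁ + b₂) * (u₁ * (v₁ + v₂) + 3 * u₂ * v₂)
    + (b₁ - 5 * b₂) * (u₂ * v₁ - u₁ * v₂)
    + c * (v₁ ^ 2 + v₁ * v₂ + 3 * v₂ ^ 2)

theorem exists_hermitianForm_eq_one_or_two (a b₁ b₂ c : ℤ) (ha : 0 < a)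
    (h : a * c = b₁ ^ 2 + b₁ * b₂ + 3 * b₂ ^ 2 + 1) :
    ∃ u₁ u₂ v₁ v₂ : ℤ, hermitianForm a b₁ b₂ c u₁ u₂ v₁ v₂ = 1 ∨
      hermitianForm a b₁ b₂ c u₁ u₂ v₁ v₂ = 2 := by
  by_cases ha3 : a < 3
  · refine ⟨1, 0, 0, 0, ?_⟩
    simp only [hermitianForm]
    lia
  obtain ⟨q₁, q₂, hq⟩ := exists_norm_sub_mul_lt (not_lt.mp ha3) b₁ b₂
  obtain ⟨c', hc'⟩ : ∃ c', c' = c - ((2 * b₁ + b₂) * (q₁ + q₂) - (b₁ - 5 * b₂) * q₂)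
      + a * (q₁ ^ 2 + q₁ * q₂ + 3 * q₂ ^ 2) := ⟨_, rfl⟩
  have hac : a * c' = (b₁ - a * q₁) ^ 2 + (b₁ - a * q₁) * (b₂ - a * q₂)
      + 3 * (b₂ - a * q₂) ^ 2 + 1 := by
    rw [hc']
    linear_combination h
  have hlt : c' < a := by
    by_contra! hle
    nlinarith
  have hpos : 0 < c' := by
    by_contra! hle
    nlinarith [sq_nonneg (2 * (b₁ - a * q₁) + (b₂ - a * q₂)), sq_nonneg (b₂ - a * q₂)]
  obtain ⟨v₁, v₂, u₁, u₂, huv⟩ := exists_hermitianForm_eq_one_or_two c'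
    ((b₁ - a * q₁) + (b₂ - a * q₂)) (-(b₂ - a * q₂)) a hpos (by linear_combination hac)
  refine ⟨u₁ - ((q₁ + q₂) * v₁ + 3 * q₂ * v₂), u₂ - (q₁ * v₂ - q₂ * v₁), v₁, v₂, ?_⟩
  convert huv using 2 <;>
  · simp only [hermitianForm, hc']
    ring
termination_by a.toNat
decreasing_by lia

theorem isSumTwoNorms_or_two_mul {p t₁ t₂ : ℤ} (hp : 0 < p)
    (h : p ∣ t₁ ^ 2 + t₁ * t₂ + 3 * t₂ ^ 2 + 1) :
    IsSumTwoNorms p ∨ IsSumTwoNorms (2 * p) := by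
  obtain ⟨a, ha⟩ := h
  have hpos : 0 < a := by
    by_contra! hle
    nlinarith [sq_nonneg (2 * t₁ + t₂), sq_nonneg t₂]
  obtain ⟨u₁, u₂, v₁, v₂, huv⟩ :=
    exists_hermitianForm_eq_one_or_two a t₁ t₂ p hpos (by linear_combination -ha)
  have key : IsSumTwoNorms (hermitianForm a t₁ t₂ p u₁ u₂ v₁ v₂ * p) := by
    refine ⟨u₁, u₂, t₁ * u₁ - 3 * t₂ * u₂ + p * v₁, t₁ * u₂ + t₂ * u₁ + t₂ * u₂ + p * v₂, ?_⟩
    simp only [hermitianForm]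
    linear_combination (u₁ ^ 2 + u₁ * u₂ + 3 * u₂ ^ 2) * ha
  obtain huv | huv := huv
  · left
    simpa [huv] using key
  · right
    simpa [huv] using key

set_option synthInstance.maxHeartbeats 400000 in
set_option synthInstance.maxSize 1024 in
set_option maxRecDepth 100000 in
theorem exists_linear_map_eq_zero_mod_four : ∀ a b c d : ZMod 4,
    a ^ 2 + a * b + 3 * b ^ 2 + c ^ 2 + c * d + 3 * d ^ 2 = 2 →
      (-2 * a - 2 * c - 2 * d = 0 ∧
        -2 * b + 2 * d = 0 ∧
        2 * a + 2 * b - 2 * c = 0 ∧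
        -2 * b - 2 * d = 0) ∨
      (2 * (a + c) = 0 ∧
        2 * (b + d) = 0 ∧
        2 * (-a + c) = 0 ∧
        2 * (-b + d) = 0) ∨
      (-a - 3 * b - c - 4 * d = 0 ∧
        -a - b + c + 2 * d = 0 ∧
        -2 * b - 2 * c + 2 * d = 0 ∧
        a - b + c = 0) ∨
      (-2 * a + 2 * b + 2 * d = 0 ∧
        a - c + d = 0 ∧
        a + 4 * b - c - 3 * d = 0 ∧
        -a - 2 * b - c - d = 0) ∨
      (-2 * b - 2 * c - 4 * d = 0 ∧
        -a - 2 * b + c + d = 0 ∧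
        a - 2 * b - c + 3 * d = 0 ∧
        a + c - d = 0) ∨
      (-a + 3 * b - c + 2 * d = 0 ∧
        a - b - c = 0 ∧
        2 * a + 4 * b - 2 * d = 0 ∧
        -a - b - c - 2 * d = 0) := by
  decide

theorem IsSumTwoNorms.of_sixteen_mul {n a b c d : ℤ}
    (h : a ^ 2 + a * b + 3 * b ^ 2 + c ^ 2 + c * d + 3 * d ^ 2 = 16 * n)
    (ha : (a : ZMod 4) = 0) (hb : (b : ZMod 4) = 0)
    (hc : (c : ZMod 4) = 0) (hd : (d : ZMod 4) = 0) : IsSumTwoNorms n := by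
  obtain ⟨a, rfl⟩ := (ZMod.intCast_zmod_eq_zero_iff_dvd a 4).mp ha
  obtain ⟨b, rfl⟩ := (ZMod.intCast_zmod_eq_zero_iff_dvd b 4).mp hb
  obtain ⟨c, rfl⟩ := (ZMod.intCast_zmod_eq_zero_iff_dvd c 4).mp hc
  obtain ⟨d, rfl⟩ := (ZMod.intCast_zmod_eq_zero_iff_dvd d 4).mp hd
  push_cast at h
  exact ⟨a, b, c, d, by linarith⟩

theorem IsSumTwoNorms.of_two_mul {n : ℤ} (hn : Odd n) (h : IsSumTwoNorms (2 * n)) :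
    IsSumTwoNorms n := by
  obtain ⟨a, b, c, d, h⟩ := h
  have hmod : (a : ZMod 4) ^ 2 + a * b + 3 * b ^ 2 + c ^ 2 + c * d + 3 * d ^ 2 = 2 := by
    obtain ⟨k, rfl⟩ := hn
    have h₄ : (4 : ZMod 4) = 0 := rfl
    have hcast := congrArg (Int.cast : ℤ → ZMod 4) h
    push_cast at hcast
    linear_combination hcast + k * h₄
  obtain ⟨h₁, h₂, h₃, h₄⟩ |
    ⟨h₁, h₂, h₃, h₄⟩ |
    ⟨h₁, h₂, h₃, h₄⟩ |
    ⟨h₁, h₂, h₃, h₄⟩ |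
    ⟨h₁, h₂, h₃, h₄⟩ |
    ⟨h₁, h₂, h₃, h₄⟩ :=
    exists_linear_map_eq_zero_mod_four a b c d hmod
  · exact of_sixteen_mul (a := -2 * a - 2 * c - 2 * d) (b := -2 * b + 2 * d)
      (c := 2 * a + 2 * b - 2 * c) (d := -2 * b - 2 * d)
      (by linear_combination 8 * h) (by exact_mod_cast h₁) (by exact_mod_cast h₂)
      (by exact_mod_cast h₃) (by exact_mod_cast h₄)
  · exact of_sixteen_mul (a := 2 * (a + c)) (b := 2 * (b + d))
      (c := 2 * (-a + c)) (d := 2 * (-b + d))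
      (by linear_combination 8 * h) (by exact_mod_cast h₁) (by exact_mod_cast h₂)
      (by exact_mod_cast h₃) (by exact_mod_cast h₄)
  · exact of_sixteen_mul (a := -a - 3 * b - c - 4 * d) (b := -a - b + c + 2 * d)
      (c := -2 * b - 2 * c + 2 * d) (d := a - b + c)
      (by linear_combination 8 * h) (by exact_mod_cast h₁) (by exact_mod_cast h₂)
      (by exact_mod_cast h₃) (by exact_mod_cast h₄)
  · exact of_sixteen_mul (a := -2 * a + 2 * b + 2 * d) (b := a - c + d)
      (c := a + 4 * b - c - 3 * d) (d := -a - 2 * b - c - d)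
      (by linear_combination 8 * h) (by exact_mod_cast h₁) (by exact_mod_cast h₂)
      (by exact_mod_cast h₃) (by exact_mod_cast h₄)
  · exact of_sixteen_mul (a := -2 * b - 2 * c - 4 * d) (b := -a - 2 * b + c + d)
      (c := a - 2 * b - c + 3 * d) (d := a + c - d)
      (by linear_combination 8 * h) (by exact_mod_cast h₁) (by exact_mod_cast h₂)
      (by exact_mod_cast h₃) (by exact_mod_cast h₄)
  · exact of_sixteen_mul (a := -a + 3 * b - c + 2 * d) (b := a - b - c)
      (c := 2 * a + 4 * b - 2 * d) (d := -a - b - c - 2 * d)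
      (by linear_combination 8 * h) (by exact_mod_cast h₁) (by exact_mod_cast h₂)
      (by exact_mod_cast h₃) (by exact_mod_cast h₄)

theorem exists_dvd_norm_add_one {p : ℕ} (hp : p.Prime) (hp11 : p ≠ 11) :
    ∃ t₁ t₂ : ℤ, (p : ℤ) ∣ t₁ ^ 2 + t₁ * t₂ + 3 * t₂ ^ 2 + 1 := by
  have : Fact p.Prime := ⟨hp⟩
  obtain rfl | hp2 := hp.eq_two_or_odd
  · exact ⟨1, 0, by norm_num⟩
  have h11 : (11 : ZMod p) ≠ 0 := by
    intro h
    have hdvd : p ∣ 11 := (ZMod.natCast_eq_zero_iff 11 p).mp (by exact_mod_cast h)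
    exact hp11 ((Nat.prime_dvd_prime_iff_eq hp (by norm_num)).mp hdvd)
  obtain ⟨x, y, hxy⟩ := FiniteField.exists_root_sum_quadratic (R := ZMod p)
    (f := Polynomial.X ^ 2)
    (g := Polynomial.C 11 * Polynomial.X ^ 2 + Polynomial.C 0 * Polynomial.X + Polynomial.C 1)
    (Polynomial.degree_X_pow 2) (Polynomial.degree_quadratic h11)
    (by rw [ZMod.card]; exact hp2)
  obtain ⟨x, rfl⟩ := ZMod.intCast_surjective x
  obtain ⟨y, rfl⟩ := ZMod.intCast_surjective y
  refine ⟨x - y, 2 * y, (ZMod.intCast_zmod_eq_zero_iff_dvd _ p).mp ?_⟩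
  simp at hxy
  push_cast
  linear_combination hxy

theorem IsSumTwoNorms.of_prime {p : ℕ} (hp : p.Prime) : IsSumTwoNorms p := by
  obtain rfl | hp11 := eq_or_ne p 11
  · exact ⟨-1, 2, 0, 0, by norm_num⟩
  obtain rfl | hp2 := hp.eq_two_or_odd'
  · exact ⟨1, 0, 1, 0, by norm_num⟩
  obtain ⟨t₁, t₂, ht⟩ := exists_dvd_norm_add_one hp hp11
  obtain h | h := isSumTwoNorms_or_two_mul (by exact_mod_cast hp.pos) ht
  · exact h
  · exact h.of_two_mul (by exact_mod_cast hp2)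

theorem stmt_18 (n : ℕ) (hn : 0 < n) :
    ∃ x₁ x₂ y₁ y₂ : ℤ,
      x₁ ^ 2 + x₁ * x₂ + 3 * x₂ ^ 2 + y₁ ^ 2 + y₁ * y₂ + 3 * y₂ ^ 2 = (n : ℤ) := by
  change IsSumTwoNorms n
  induction n using Nat.recOnMul with
  | zero => exact absurd hn (lt_irrefl 0)
  | one => exact ⟨1, 0, 0, 0, by norm_num⟩
  | prime p hp => exact .of_prime hp
  | mul a b iha ihb =>
    rw [Nat.cast_mul]
    exact (iha (Nat.pos_of_mul_pos_right hn)).mul (ihb (Nat.pos_of_mul_pos_left hn))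
end
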